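/- arXiv:1602.00767 — 6 statements merged into one kernel-verified Lean document; each statement's English description precedes it below -/
import Mathlib

section
/- Let V be a finite set of n ≥ 3 points in the Euclidean plane ℝ² in convex position (every point of V is an extreme point of P := convexHull ℝ V), and assume P has nonempty interior. Then there exists a finite family F of 3-element subsets of V such that: (a) the union of the sets convexHull ℝ t over t ∈ F equals P; (b) for any two distinct t, t' ∈ F the interiors of convexHull ℝ t and convexHull ℝ t' are disjoint; and (c) for every t ∈ F and every point p ∈ convexHull ℝ t one has (infDist p (frontier P))² ≤ area(convexHull ℝ t). (That is, every convex polygon admits a triangulation with the 1-distance property.) -/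
open Metric MeasureTheory

/-- Twice the signed area of the triangle `a b x`. -/
noncomputable def orient (a b x : EuclideanSpace ℝ (Fin 2)) : ℝ :=
  (b 0 - a 0) * (x 1 - a 1) - (b 1 - a 1) * (x 0 - a 0)

local notation "ℝ²" => EuclideanSpace ℝ (Fin 2)

theorem orient_self_right (a b : ℝ²) : orient a b b = 0 := by simp [orient]; ring

theorem orient_self_left (a b : ℝ²) : orient a b a = 0 := by simp [orient]

theorem orient_swap (a b x : ℝ²) : orient b a x = -orient a b x := by simp [orient]; ring

theorem orient_rotate (a b x : ℝ²) : orient b x a = orient a b x := by simp [orient]; ring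

theorem orient_combo (a b x y : ℝ²) {s t : ℝ} (h : s + t = 1) :
    orient a b (s • x + t • y) = s * orient a b x + t * orient a b y := by
  obtain rfl : t = 1 - s := by linarith
  simp [orient]; ring

theorem orient_add_add (a b w x : ℝ²) :
    orient b w x + orient w a x + orient a b x = orient a b w := by
  simp [orient]; ring

/-- Barycentric coordinates with respect to the triangle `a b w`, cleared of denominators. -/
theorem orient_smul_eq (a b w x : ℝ²) :
    orient a b w • x = orient b w x • a + orient w a x • b + orient a b x • w := by
  ext i
  fin_cases i <;> simp [orient] <;> ring

theorem convex_setOf_orient_le (a b : ℝ²) (c : ℝ) : Convex ℝ {x | orient a b x ≤ c} := by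
  intro x hx y hy s t hs ht h
  simp only [Set.mem_ofPred_eq, orient_combo a b x y h] at *
  calc s * orient a b x + t * orient a b y ≤ s * c + t * c := by gcongr
    _ = c := by rw [← add_mul, h, one_mul]

theorem convex_setOf_le_orient (a b : ℝ²) (c : ℝ) : Convex ℝ {x | c ≤ orient a b x} := by
  convert convex_setOf_orient_le b a (-c) using 3 with x
  rw [orient_swap a b, neg_le_neg_iff]

theorem orient_le_of_mem_convexHull {s : Set ℝ²} {a b x : ℝ²} {c : ℝ}
    (h : ∀ v ∈ s, orient a b v ≤ c) (hx : x ∈ convexHull ℝ s) : orient a b x ≤ c :=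
  convexHull_min h (convex_setOf_orient_le a b c) hx

theorem le_orient_of_mem_convexHull {s : Set ℝ²} {a b x : ℝ²} {c : ℝ}
    (h : ∀ v ∈ s, c ≤ orient a b v) (hx : x ∈ convexHull ℝ s) : c ≤ orient a b x :=
  convexHull_min h (convex_setOf_le_orient a b c) hx

/-- An extreme point that is a convex combination of three points is equal to any of
those carrying positive weight, provided another one does too. -/
theorem eq_of_mem_extremePoints_of_smul_eq {P : Set ℝ²} (hP : Convex ℝ P) {a x y z : ℝ²}
    (ha : a ∈ P.extremePoints ℝ) (hx : x ∈ P) (hy : y ∈ P) (hz : z ∈ P) {r s t : ℝ}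
    (hr : 0 < r) (hs : 0 < s) (ht : 0 ≤ t)
    (h : (r + s + t) • a = r • x + s • y + t • z) : y = a := by
  have hrt : 0 < r + t := by linarith
  have hsum : 0 < r + s + t := by linarith
  have hm : (r / (r + t)) • x + (t / (r + t)) • z ∈ P :=
    hP hx hz (by positivity) (by positivity) (by field_simp)
  refine ha.2 hy hm ⟨s / (r + s + t), (r + t) / (r + s + t), by positivity, by positivity,
    by field_simp; ring, ?_⟩
  rw [← smul_right_inj hsum.ne', h]
  match_scalars <;> field_simp

/-- The distance from a point of a closed set to its frontier is at most the distance to any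
point outside. -/
theorem infDist_frontier_le_dist {P : Set ℝ²} {p q : ℝ²} (hp : p ∈ P) (hq : q ∉ P) :
    infDist p (frontier P) ≤ dist p q := by
  obtain ⟨z, hz, hzP⟩ := isPreconnected_closed_iff.1 (convex_segment p q).isPreconnected
    (closure P) (closure Pᶜ) isClosed_closure isClosed_closure
    (fun x _ => (em (x ∈ P)).imp (subset_closure ·) (subset_closure ·))
    ⟨p, left_mem_segment ℝ p q, subset_closure hp⟩ ⟨q, right_mem_segment ℝ p q, subset_closure hq⟩
  rw [← frontier_eq_closure_inter_closure] at hzP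
  have := dist_add_dist_of_mem_segment hz
  linarith [infDist_le_dist_of_mem (x := p) hzP, dist_nonneg (x := z) (y := q)]

theorem disjoint_interior_of_le {A B : Set ℝ²} (g : ℝ² → ℝ) {z : ℝ²} {c d : ℝ}
    (hg : ∀ (x : ℝ²) (ε : ℝ), g (x + ε • z) = g x + ε * d) (hd : 0 < d)
    (hA : ∀ x ∈ A, g x ≤ c) (hB : ∀ x ∈ B, c ≤ g x) : Disjoint (interior A) (interior B) := by
  rw [Set.disjoint_left]
  intro x hxA hxB
  have hev : ∀ᶠ ε : ℝ in nhds 0, x + ε • z ∈ interior A := by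
    apply (show Continuous fun ε : ℝ => x + ε • z by fun_prop).continuousAt
    exact isOpen_interior.mem_nhds (by simpa using hxA)
  obtain ⟨ε, hmem, hε⟩ := ((hev.filter_mono nhdsWithin_le_nhds).and
    (self_mem_nhdsWithin (s := Set.Ioi (0 : ℝ)))).exists
  have h1 := hA _ (interior_subset hmem)
  have h2 := hB _ (interior_subset hxB)
  rw [hg] at h1
  nlinarith [mul_pos (Set.mem_Ioi.1 hε) hd]

theorem disjoint_interior_of_orient {A B : Set ℝ²} {a b : ℝ²} (hab : a ≠ b)
    (hA : ∀ x ∈ A, orient a b x ≤ 0) (hB : ∀ x ∈ B, 0 ≤ orient a b x) :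
    Disjoint (interior A) (interior B) := by
  refine disjoint_interior_of_le (orient a b) (z := !₂[-(b 1 - a 1), b 0 - a 0])
    (d := dist a b ^ 2) (fun x ε => ?_) (by have := dist_pos.2 hab; positivity) hA hB
  rw [EuclideanSpace.dist_eq, Real.sq_sqrt (by positivity)]
  simp [orient, Fin.sum_univ_two, Real.dist_eq, sq_abs]
  ring

theorem smul_add_smul_add_smul_mem {S : Set ℝ²} (hS : Convex ℝ S) {a b w : ℝ²} (ha : a ∈ S)
    (hb : b ∈ S) (hw : w ∈ S) {r s t : ℝ} (hr : 0 ≤ r) (hs : 0 ≤ s) (ht : 0 ≤ t)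
    (h : r + s + t = 1) : r • a + s • b + t • w ∈ S := by
  have := hS.sum_mem (t := Finset.univ) (w := ![r, s, t]) (z := ![a, b, w])
    (by intro i _; fin_cases i <;> simpa) (by simpa [Fin.sum_univ_three] using h)
    (by intro i _; fin_cases i <;> simpa)
  simpa [Fin.sum_univ_three] using this

theorem mem_convexHull_triple {a b w x : ℝ²} (hw : 0 < orient a b w) (h1 : 0 ≤ orient a b x)
    (h2 : 0 ≤ orient b w x) (h3 : 0 ≤ orient w a x) :
    x ∈ convexHull ℝ ({a, b, w} : Set ℝ²) := by
  have key : x = (orient b w x / orient a b w) • a + (orient w a x / orient a b w) • b +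
      (orient a b x / orient a b w) • w := by
    rw [← smul_right_inj hw.ne', orient_smul_eq]
    match_scalars <;> field_simp
  rw [key]
  exact smul_add_smul_add_smul_mem (convex_convexHull ℝ _) (subset_convexHull ℝ _ (by simp))
    (subset_convexHull ℝ _ (by simp)) (subset_convexHull ℝ _ (by simp)) (by positivity)
    (by positivity) (by positivity) (by
      rw [← add_div, ← add_div, orient_add_add, div_self hw.ne'])

theorem orient_div_two_le_volume (a b w : ℝ²) :
    orient a b w / 2 ≤ (volume (convexHull ℝ ({a, b, w} : Set ℝ²))).toReal := by
  set T := convexHull ℝ ({a, b, w} : Set ℝ²)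
  have hTc : IsCompact T := Set.Finite.isCompact_convexHull ℝ (Set.toFinite _)
  have ha : a ∈ T := subset_convexHull ℝ _ (by simp)
  have hb : b ∈ T := subset_convexHull ℝ _ (by simp)
  have hw : w ∈ T := subset_convexHull ℝ _ (by simp)
  have hmem : ∀ r s : ℝ, 0 ≤ r → 0 ≤ s → r + s ≤ 1 → a + r • (b - a) + s • (w - a) ∈ T := by
    intro r s hr hs hrs
    convert smul_add_smul_add_smul_mem (convex_convexHull ℝ _) ha hb hw (sub_nonneg.2 hrs) hr hs
      (by ring) using 1
    module
  have hsub : parallelepiped ![b - a, w - a] ⊆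
      (fun x => x + a) ⁻¹' T ∪ (fun x => (b + w - a) - x) ⁻¹' T := by
    intro x hx
    obtain ⟨t, ht, rfl⟩ := (mem_parallelepiped_iff _ _).1 hx
    have h00 := ht.1 0
    have h01 := ht.1 1
    have h10 := ht.2 0
    have h11 := ht.2 1
    simp only [Pi.zero_apply, Pi.one_apply] at h00 h01 h10 h11
    rcases le_total (t 0 + t 1) 1 with h | h
    · left
      rw [Set.mem_preimage]
      convert hmem _ _ h00 h01 h using 1
      simp [Fin.sum_univ_two]
      abel
    · right
      rw [Set.mem_preimage]
      convert hmem (1 - t 0) (1 - t 1) (by linarith) (by linarith) (by linarith) using 1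
      simp [Fin.sum_univ_two]
      module
  have hpar : volume (parallelepiped ![b - a, w - a]) = ENNReal.ofReal |orient a b w| := by
    rw [← (EuclideanSpace.basisFun (Fin 2) ℝ).addHaar_eq_volume, Measure.addHaar_parallelepiped,
      Module.Basis.det_apply, Matrix.det_fin_two]
    congr 2
    simp [Module.Basis.toMatrix_apply, orient]
    ring
  have hle : ENNReal.ofReal |orient a b w| ≤ volume T + volume T := by
    rw [← hpar]
    refine (measure_mono hsub).trans ((measure_union_le _ _).trans (le_of_eq ?_))
    rw [measure_preimage_add_right, (Measure.measurePreserving_sub_left volume _).measure_preimage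
      hTc.measurableSet.nullMeasurableSet]
  have hfin : volume T ≠ ⊤ := hTc.measure_lt_top.ne
  have := ENNReal.toReal_mono (by simp [hfin]) hle
  rw [ENNReal.toReal_add hfin hfin, ENNReal.toReal_ofReal (abs_nonneg _)] at this
  linarith [le_abs_self (orient a b w)]

theorem infDist_frontier_sq_le {P : Set ℝ²} {f : ℝ² →ₗ[ℝ] ℝ} {a b p : ℝ²} {H : ℝ}
    (hab : f a < f b) (hH : ∀ x ∈ P, orient a b x ≤ H)
    (hf : ∀ x ∈ P, 0 ≤ orient a b x → f a ≤ f x ∧ f x ≤ f b)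
    (hp : p ∈ P) (hp0 : 0 ≤ orient a b p) : infDist p (frontier P) ^ 2 ≤ H / 2 := by
  have hne : a ≠ b := by rintro rfl; exact hab.false
  have hL : 0 < dist a b := dist_pos.2 hne
  have hH0 : 0 ≤ H := hp0.trans (hH p hp)
  have hLsq : dist a b ^ 2 = (a 0 - b 0) ^ 2 + (a 1 - b 1) ^ 2 := by
    rw [EuclideanSpace.dist_eq, Real.sq_sqrt (by positivity)]
    simp [Fin.sum_univ_two, Real.dist_eq, sq_abs]
  have h1 : infDist p (frontier P) ≤ H / dist a b := by
    refine le_of_forall_gt_imp_ge_of_dense fun s hs => ?_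
    have hs0 : 0 < s := lt_of_le_of_lt (by positivity) hs
    set q : ℝ² := p + (s / dist a b) • !₂[-(b 1 - a 1), b 0 - a 0] with hq
    have hqo : orient a b q = orient a b p + s * dist a b := by
      have : s * dist a b = s / dist a b * dist a b ^ 2 := by field_simp
      rw [this, hLsq]
      simp [hq, orient]
      ring
    have hqP : q ∉ P := fun h => by
      have := hH q h
      rw [div_lt_iff₀ hL] at hs
      linarith
    refine (infDist_frontier_le_dist hp hqP).trans (le_of_eq ?_)
    have hn : ‖(!₂[-(b 1 - a 1), b 0 - a 0] : ℝ²)‖ = dist a b := by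
      rw [← sq_eq_sq₀ (norm_nonneg _) dist_nonneg, hLsq, EuclideanSpace.norm_sq_eq]
      simp [Fin.sum_univ_two]
      ring
    rw [hq, dist_self_add_right, norm_smul, hn, Real.norm_of_nonneg (by positivity)]
    field_simp
  have h2 : infDist p (frontier P) ≤ dist a b / 2 := by
    refine le_of_forall_gt_imp_ge_of_dense fun s hs => ?_
    have hs0 : 0 < s := lt_of_le_of_lt (by positivity) hs
    have hout : ∀ r : ℝ, |r| = s / dist a b → p + r • (b - a) ∉ P → infDist p (frontier P) ≤ s := by
      intro r hr h
      refine (infDist_frontier_le_dist hp h).trans (le_of_eq ?_)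
      rw [dist_self_add_right, norm_smul, Real.norm_eq_abs, hr, ← dist_eq_norm, dist_comm b a]
      field_simp
    have ho : ∀ r : ℝ, orient a b (p + r • (b - a)) = orient a b p := by
      intro r
      simp [orient]
      ring
    by_contra hcon
    have hr : 0 < s / dist a b := by positivity
    have hp1 := not_imp_comm.1 (hout (s / dist a b) (abs_of_pos hr)) hcon
    have hp2 := not_imp_comm.1 (hout (-(s / dist a b)) (by rw [abs_neg, abs_of_pos hr])) hcon
    have e1 := (hf _ hp1 (by rwa [ho])).2
    have e2 := (hf _ hp2 (by rwa [ho])).1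
    simp only [map_add, map_smul, map_sub, smul_eq_mul] at e1 e2
    have : 1 / 2 < s / dist a b := by
      rw [lt_div_iff₀ hL]
      linarith
    nlinarith
  calc infDist p (frontier P) ^ 2 = infDist p (frontier P) * infDist p (frontier P) := sq _
    _ ≤ H / dist a b * (dist a b / 2) := mul_le_mul h1 h2 infDist_nonneg (by positivity)
    _ = H / 2 := by field_simp

theorem orient_nonneg_of_left {P : Set ℝ²} (hP : Convex ℝ P) {a b w x : ℝ²}
    (ha : a ∈ P.extremePoints ℝ) (hb : b ∈ P) (hw : w ∈ P) (hx : x ∈ P)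
    (hH : 0 < orient a b w) (hxw : 0 ≤ orient a w x) : 0 ≤ orient a b x := by
  by_contra! hneg
  have hsum := orient_add_add a b w x
  have hsw := orient_swap a w x
  have : w = a := by
    refine eq_of_mem_extremePoints_of_smul_eq hP ha hx hw hb (r := orient a b w)
      (s := -orient a b x) (t := -orient w a x) hH (by linarith) (by linarith) ?_
    rw [orient_smul_eq a b w x, ← hsum]
    module
  rw [this, orient_self_left] at hH
  exact hH.false

theorem orient_nonneg_of_right {P : Set ℝ²} (hP : Convex ℝ P) {a b w x : ℝ²}
    (hb : b ∈ P.extremePoints ℝ) (ha : a ∈ P) (hw : w ∈ P) (hx : x ∈ P)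
    (hH : 0 < orient a b w) (hxw : 0 ≤ orient w b x) : 0 ≤ orient a b x := by
  by_contra! hneg
  have hsum := orient_add_add a b w x
  have hsw := orient_swap w b x
  have : w = b := by
    refine eq_of_mem_extremePoints_of_smul_eq hP hb hx hw ha (r := orient a b w)
      (s := -orient a b x) (t := -orient b w x) hH (by linarith) (by linarith) ?_
    rw [orient_smul_eq a b w x, ← hsum]
    module
  rw [this, orient_self_right] at hH
  exact hH.false

/-- The part of `P` to the left of the directed line `a b` lies in the strip between the
level lines of `f` through `a` and `b`. -/
def CapInStrip (P : Set ℝ²) (f : ℝ² →ₗ[ℝ] ℝ) (a b : ℝ²) : Prop :=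
  ∀ x ∈ P, 0 ≤ orient a b x → f a ≤ f x ∧ f x ≤ f b

section Strip

variable {P : Set ℝ²} {f : ℝ² →ₗ[ℝ] ℝ} {a b w : ℝ²}

theorem orient_mul_map_eq (f : ℝ² →ₗ[ℝ] ℝ) (a b w x : ℝ²) :
    orient a b w * f x = orient b w x * f a + orient w a x * f b + orient a b x * f w := by
  simpa using congrArg f (orient_smul_eq a b w x)

theorem CapInStrip.left (h : CapInStrip P f a b) (hP : Convex ℝ P) (ha : a ∈ P.extremePoints ℝ)
    (hb : b ∈ P) (hw : w ∈ P) (hH : 0 < orient a b w)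
    (hmax : ∀ x ∈ P, orient a b x ≤ orient a b w) : CapInStrip P f a w := by
  intro x hx hxw
  have h0 := orient_nonneg_of_left hP ha hb hw hx hH hxw
  refine ⟨(h x hx h0).1, ?_⟩
  obtain ⟨hfa, hfb⟩ := h w hw hH.le
  have hsum := orient_add_add a b w x
  have hsw := orient_swap a w x
  have hm := hmax x hx
  have key := orient_mul_map_eq f a b w x
  refine le_of_mul_le_mul_left ?_ hH
  have e1 : 0 ≤ (orient b w x + orient w a x) * (f w - f a) :=
    mul_nonneg (by linarith) (by linarith)
  have e2 : 0 ≤ -orient w a x * (f b - f a) := mul_nonneg (by linarith) (by linarith)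
  rw [key, ← hsum]
  linarith

theorem CapInStrip.right (h : CapInStrip P f a b) (hP : Convex ℝ P)
    (hb : b ∈ P.extremePoints ℝ) (ha : a ∈ P) (hw : w ∈ P) (hH : 0 < orient a b w)
    (hmax : ∀ x ∈ P, orient a b x ≤ orient a b w) : CapInStrip P f w b := by
  intro x hx hxw
  have h0 := orient_nonneg_of_right hP hb ha hw hx hH hxw
  refine ⟨?_, (h x hx h0).2⟩
  obtain ⟨hfa, hfb⟩ := h w hw hH.le
  have hsum := orient_add_add a b w x
  have hsw := orient_swap w b x
  have hm := hmax x hx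
  have key := orient_mul_map_eq f a b w x
  refine le_of_mul_le_mul_left ?_ hH
  have e1 : 0 ≤ (orient b w x + orient w a x) * (f b - f w) :=
    mul_nonneg (by linarith) (by linarith)
  have e2 : 0 ≤ -orient b w x * (f b - f a) := mul_nonneg (by linarith) (by linarith)
  rw [key, ← hsum]
  linarith

theorem CapInStrip.mem_segment (h : CapInStrip P f a b) (hab : f a < f b) {x : ℝ²} (hx : x ∈ P)
    (h0 : orient a b x = 0) : x ∈ segment ℝ a b := by
  obtain ⟨h1, h2⟩ := h x hx h0.ge
  have hd : 0 < f b - f a := by linarith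
  have hne : a ≠ b := by rintro rfl; exact hab.false
  obtain ⟨r, hr⟩ : ∃ r : ℝ, x = a + r • (b - a) := by
    simp only [orient] at h0
    by_cases hb0 : b 0 - a 0 = 0
    · have hb1 : b 1 - a 1 ≠ 0 := by
        intro hb1
        apply hne
        ext i
        fin_cases i
        · simpa using (sub_eq_zero.1 hb0).symm
        · simpa using (sub_eq_zero.1 hb1).symm
      refine ⟨(x 1 - a 1) / (b 1 - a 1), ?_⟩
      rw [hb0, zero_mul, zero_sub, neg_eq_zero, mul_eq_zero, or_iff_right hb1] at h0
      ext i
      fin_cases i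
      · simp [hb0]
        linarith
      · simp [hb1]
    · refine ⟨(x 0 - a 0) / (b 0 - a 0), ?_⟩
      ext i
      fin_cases i
      · simp [hb0]
      · simp
        field_simp
        linarith
  have hfx : f x = f a + r * (f b - f a) := by simp [hr]
  have hr0 : 0 ≤ r := by
    by_contra! hlt
    nlinarith
  have hr1 : r ≤ 1 := by
    by_contra! hlt
    nlinarith
  exact ⟨1 - r, r, by linarith, hr0, by ring, by rw [hr]; module⟩

end Strip

/-- `F` triangulates the part of the polygon with vertex set `V` to the left of the directed
line `a b`, which may be reduced to the segment from `a` to `b`, by triangles with the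
1-distance property. -/
structure IsCapTriangulation (V : Finset ℝ²) (a b : ℝ²) (F : Finset (Finset ℝ²)) : Prop where
  subset_card : ∀ t ∈ F, t ⊆ V ∧ t.card = 3
  orient_nonneg : ∀ t ∈ F, ∀ x ∈ convexHull ℝ (t : Set ℝ²), 0 ≤ orient a b x
  cover : ∀ x ∈ convexHull ℝ (V : Set ℝ²), 0 ≤ orient a b x →
    x ∈ segment ℝ a b ∨ ∃ t ∈ F, x ∈ convexHull ℝ (t : Set ℝ²)
  cover_segment : (∃ v ∈ V, 0 < orient a b v) →
    ∀ x ∈ segment ℝ a b, ∃ t ∈ F, x ∈ convexHull ℝ (t : Set ℝ²)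
  disjoint : ∀ t ∈ F, ∀ t' ∈ F, t ≠ t' →
    Disjoint (interior (convexHull ℝ (t : Set ℝ²))) (interior (convexHull ℝ (t' : Set ℝ²)))
  dist_sq_le : ∀ t ∈ F, ∀ p ∈ convexHull ℝ (t : Set ℝ²),
    infDist p (frontier (convexHull ℝ (V : Set ℝ²))) ^ 2
      ≤ (volume (convexHull ℝ (t : Set ℝ²))).toReal

theorem IsCapTriangulation.convexHull_subset {V : Finset ℝ²} {a b : ℝ²} {F : Finset (Finset ℝ²)}
    (h : IsCapTriangulation V a b F) {t : Finset ℝ²} (ht : t ∈ F) :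
    convexHull ℝ (t : Set ℝ²) ⊆ convexHull ℝ (V : Set ℝ²) :=
  convexHull_mono (Finset.coe_subset.2 (h.subset_card t ht).1)

open Classical in
/-- Glue triangulations of the caps over `a w` and `w b` to the triangle `a b w`, where `w` is
a vertex at maximal distance from `a b`. -/
theorem IsCapTriangulation.glue {V : Finset ℝ²}
    (hext : ∀ v ∈ V, v ∈ (convexHull ℝ (V : Set ℝ²)).extremePoints ℝ) {f : ℝ² →ₗ[ℝ] ℝ}
    {a b w : ℝ²} (ha : a ∈ V) (hb : b ∈ V) (hw : w ∈ V) (hab : f a < f b)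
    (hcap : CapInStrip (convexHull ℝ (V : Set ℝ²)) f a b) (hH : 0 < orient a b w)
    (hmax : ∀ x ∈ convexHull ℝ (V : Set ℝ²), orient a b x ≤ orient a b w)
    {F G : Finset (Finset ℝ²)} (hF : IsCapTriangulation V a w F)
    (hG : IsCapTriangulation V w b G) :
    IsCapTriangulation V a b (insert {a, b, w} (F ∪ G)) := by
  set P := convexHull ℝ (V : Set ℝ²)
  have hP : Convex ℝ P := convex_convexHull ℝ _
  have hVP : ∀ v ∈ V, v ∈ P := fun v hv => subset_convexHull ℝ _ hv
  have hwa : w ≠ a := by rintro rfl; simp [orient_self_left] at hH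
  have hwb : w ≠ b := by rintro rfl; simp [orient_self_right] at hH
  have hne : a ≠ b := by rintro rfl; exact hab.false
  have hT : ((({a, b, w} : Finset ℝ²)) : Set ℝ²) = {a, b, w} := by simp
  have hTV : ({a, b, w} : Finset ℝ²) ⊆ V := by
    intro x hx
    simp only [Finset.mem_insert, Finset.mem_singleton] at hx
    rcases hx with rfl | rfl | rfl <;> assumption
  have hTo : ∀ x ∈ convexHull ℝ ({a, b, w} : Set ℝ²),
      0 ≤ orient a b x ∧ orient a w x ≤ 0 ∧ orient w b x ≤ 0 := by
    intro x hx
    refine ⟨le_orient_of_mem_convexHull ?_ hx, orient_le_of_mem_convexHull ?_ hx,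
      orient_le_of_mem_convexHull ?_ hx⟩
    · rintro v (rfl | rfl | rfl)
      exacts [(orient_self_left _ _).ge, (orient_self_right _ _).ge, hH.le]
    · rintro v (rfl | rfl | rfl)
      · exact (orient_self_left _ _).le
      · rw [orient_swap, orient_rotate v w a, orient_rotate a v w, neg_nonpos]
        exact hH.le
      · exact (orient_self_right _ _).le
    · rintro v (rfl | rfl | rfl)
      · rw [orient_swap, orient_rotate v b w, neg_nonpos]
        exact hH.le
      · exact (orient_self_right _ _).le
      · exact (orient_self_left _ _).le
  have hsegT : ∀ {u v x : ℝ²}, u ∈ ({a, b, w} : Set ℝ²) → v ∈ ({a, b, w} : Set ℝ²) →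
      x ∈ segment ℝ u v → x ∈ convexHull ℝ ({a, b, w} : Set ℝ²) := fun hu hv hx =>
    (convex_convexHull ℝ _).segment_subset (subset_convexHull ℝ _ hu)
      (subset_convexHull ℝ _ hv) hx
  have hTF : ∀ t ∈ F, Disjoint (interior (convexHull ℝ ({a, b, w} : Set ℝ²)))
      (interior (convexHull ℝ (t : Set ℝ²))) := fun t ht =>
    disjoint_interior_of_orient hwa.symm (fun x hx => (hTo x hx).2.1) (hF.orient_nonneg t ht)
  have hTG : ∀ t ∈ G, Disjoint (interior (convexHull ℝ ({a, b, w} : Set ℝ²)))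
      (interior (convexHull ℝ (t : Set ℝ²))) := fun t ht =>
    disjoint_interior_of_orient hwb (fun x hx => (hTo x hx).2.2) (hG.orient_nonneg t ht)
  have hFG : ∀ t ∈ F, ∀ t' ∈ G, Disjoint (interior (convexHull ℝ (t : Set ℝ²)))
      (interior (convexHull ℝ (t' : Set ℝ²))) := fun t ht t' ht' =>
    disjoint_interior_of_le f (z := b - a) (c := f w) (d := f b - f a) (by simp)
      (by linarith)
      (fun x hx => (hcap.left hP (hext a ha) (hVP b hb) (hVP w hw) hH hmax x
        (hF.convexHull_subset ht hx) (hF.orient_nonneg t ht x hx)).2)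
      (fun x hx => (hcap.right hP (hext b hb) (hVP a ha) (hVP w hw) hH hmax x
        (hG.convexHull_subset ht' hx) (hG.orient_nonneg t' ht' x hx)).1)
  refine ⟨?_, ?_, ?_, ?_, ?_, ?_⟩
  · intro t ht
    simp only [Finset.mem_insert, Finset.mem_union] at ht
    rcases ht with rfl | ht | ht
    · exact ⟨hTV, Finset.card_eq_three.2 ⟨a, b, w, hne, hwa.symm, hwb.symm, rfl⟩⟩
    · exact hF.subset_card t ht
    · exact hG.subset_card t ht
  · intro t ht x hx
    simp only [Finset.mem_insert, Finset.mem_union] at ht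
    rcases ht with rfl | ht | ht
    · exact (hTo x (hT ▸ hx)).1
    · exact orient_nonneg_of_left hP (hext a ha) (hVP b hb) (hVP w hw)
        (hF.convexHull_subset ht hx) hH (hF.orient_nonneg t ht x hx)
    · exact orient_nonneg_of_right hP (hext b hb) (hVP a ha) (hVP w hw)
        (hG.convexHull_subset ht hx) hH (hG.orient_nonneg t ht x hx)
  · intro x hx hx0
    right
    simp only [Finset.exists_mem_insert, hT, Finset.mem_union]
    by_cases h1 : 0 ≤ orient a w x
    · rcases hF.cover x hx h1 with h | ⟨t, ht, h⟩
      · exact Or.inl (hsegT (by simp) (by simp) h)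
      · exact Or.inr ⟨t, Or.inl ht, h⟩
    by_cases h2 : 0 ≤ orient w b x
    · rcases hG.cover x hx h2 with h | ⟨t, ht, h⟩
      · exact Or.inl (hsegT (by simp) (by simp) h)
      · exact Or.inr ⟨t, Or.inr ht, h⟩
    left
    have e1 := orient_swap a w x
    have e2 := orient_swap w b x
    exact mem_convexHull_triple hH hx0 (by linarith) (by linarith)
  · intro _ x hx
    exact ⟨_, Finset.mem_insert_self _ _, hT ▸ hsegT (by simp) (by simp) hx⟩
  · intro t ht t' ht' hne
    simp only [Finset.mem_insert, Finset.mem_union] at ht ht'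
    rcases ht with rfl | ht | ht <;> rcases ht' with rfl | ht' | ht'
    · exact absurd rfl hne
    · exact hT ▸ hTF t' ht'
    · exact hT ▸ hTG t' ht'
    · exact hT ▸ (hTF t ht).symm
    · exact hF.disjoint t ht t' ht' hne
    · exact hFG t ht t' ht'
    · exact hT ▸ (hTG t ht).symm
    · exact (hFG t' ht' t ht).symm
    · exact hG.disjoint t ht t' ht' hne
  · intro t ht p hp
    simp only [Finset.mem_insert, Finset.mem_union] at ht
    rcases ht with rfl | ht | ht
    · have hpP : p ∈ P := convexHull_mono (Finset.coe_subset.2 hTV) hp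
      rw [hT] at hp ⊢
      exact (infDist_frontier_sq_le hab hmax hcap hpP (hTo p hp).1).trans
        (orient_div_two_le_volume a b w)
    · exact hF.dist_sq_le t ht p hp
    · exact hG.dist_sq_le t ht p hp

theorem exists_isCapTriangulation {V : Finset ℝ²}
    (hext : ∀ v ∈ V, v ∈ (convexHull ℝ (V : Set ℝ²)).extremePoints ℝ) {f : ℝ² →ₗ[ℝ] ℝ}
    (hf : Set.InjOn f V) {a b : ℝ²} (ha : a ∈ V) (hb : b ∈ V) (hab : f a < f b)
    (hcap : CapInStrip (convexHull ℝ (V : Set ℝ²)) f a b) :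
    ∃ F, IsCapTriangulation V a b F := by
  classical
  induction hk : (V.filter fun v => f a ≤ f v ∧ f v ≤ f b).card using Nat.strong_induction_on
    generalizing a b with
  | _ k ih =>
  subst hk
  have hP : Convex ℝ (convexHull ℝ (V : Set ℝ²)) := convex_convexHull ℝ _
  have hVP : ∀ v ∈ V, v ∈ convexHull ℝ (V : Set ℝ²) := fun v hv => subset_convexHull ℝ _ hv
  by_cases hex : ∃ v ∈ V, 0 < orient a b v
  · obtain ⟨w, hw, hwmax⟩ := V.exists_max_image (orient a b) ⟨a, ha⟩
    have hH : 0 < orient a b w := by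
      obtain ⟨v, hv, hv0⟩ := hex
      exact hv0.trans_le (hwmax v hv)
    have hmax : ∀ x ∈ convexHull ℝ (V : Set ℝ²), orient a b x ≤ orient a b w := fun x hx =>
      orient_le_of_mem_convexHull hwmax hx
    have hwa : w ≠ a := by rintro rfl; simp [orient_self_left] at hH
    have hwb : w ≠ b := by rintro rfl; simp [orient_self_right] at hH
    obtain ⟨h1, h2⟩ := hcap w (hVP w hw) hH.le
    have haw : f a < f w := h1.lt_of_ne fun h => hwa (hf hw ha h.symm)
    have hwb' : f w < f b := h2.lt_of_ne fun h => hwb (hf hw hb h)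
    obtain ⟨F, hF⟩ := ih _ (Finset.card_lt_card (Finset.ssubset_iff_of_subset
      (fun v hv => by
        simp only [Finset.mem_filter] at hv ⊢
        exact ⟨hv.1, hv.2.1, hv.2.2.trans h2⟩) |>.2
        ⟨b, by simp [hb, hab.le], by simp [hwb']⟩)) ha hw haw
      (hcap.left hP (hext a ha) (hVP b hb) (hVP w hw) hH hmax) rfl
    obtain ⟨G, hG⟩ := ih _ (Finset.card_lt_card (Finset.ssubset_iff_of_subset
      (fun v hv => by
        simp only [Finset.mem_filter] at hv ⊢
        exact ⟨hv.1, h1.trans hv.2.1, hv.2.2⟩) |>.2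
        ⟨a, by simp [ha, hab.le], by simp [haw]⟩)) hw hb hwb'
      (hcap.right hP (hext b hb) (hVP a ha) (hVP w hw) hH hmax) rfl
    exact ⟨_, hF.glue hext ha hb hw hab hcap hH hmax hG⟩
  · push Not at hex
    refine ⟨∅, by simp, by simp, fun x hx h0 => Or.inl ?_, ?_, by simp, by simp⟩
    · exact hcap.mem_segment hab hx (le_antisymm (orient_le_of_mem_convexHull hex hx) h0)
    · rintro ⟨v, hv, h⟩
      exact absurd h (hex v hv).not_gt

/-- A linear functional on the plane can be chosen to separate the points of a finite set. -/
theorem exists_linearMap_injOn (V : Finset ℝ²) : ∃ f : ℝ² →ₗ[ℝ] ℝ, Set.InjOn f V := by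
  classical
  obtain ⟨c, hc⟩ := Infinite.exists_notMem_finset
    ((V ×ˢ V).image fun q : ℝ² × ℝ² => -(q.1 0 - q.2 0) / (q.1 1 - q.2 1))
  refine ⟨((EuclideanSpace.proj 0 : ℝ² →L[ℝ] ℝ) + c • (EuclideanSpace.proj 1 : ℝ² →L[ℝ] ℝ) :
    ℝ² →L[ℝ] ℝ), fun v hv w hw h => ?_⟩
  replace h : v 0 + c * v 1 = w 0 + c * w 1 := by simpa using h
  have h1 : v 1 = w 1 := by
    by_contra hne
    refine hc (Finset.mem_image.2 ⟨(v, w), Finset.mem_product.2 ⟨hv, hw⟩, ?_⟩)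
    rw [div_eq_iff (sub_ne_zero.2 hne)]
    linarith
  have h0 : v 0 = w 0 := by
    rw [h1] at h
    linarith
  ext i
  fin_cases i <;> assumption

theorem exists_orient_ne_zero {V : Finset ℝ²}
    (hint : (interior (convexHull ℝ (V : Set ℝ²))).Nonempty) {a b : ℝ²} (hab : a ≠ b) :
    ∃ v ∈ V, orient a b v ≠ 0 := by
  by_contra! h
  have := disjoint_interior_of_orient hab
    (fun x hx => orient_le_of_mem_convexHull (fun v hv => (h v hv).le) hx)
    (fun x hx => le_orient_of_mem_convexHull (fun v hv => (h v hv).ge) hx)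
  exact hint.ne_empty (disjoint_self.1 this)

/-- Every convex polygon admits a triangulation with the 1-distance property. -/
theorem convex_polygon_triangulation_one_distance_property
    (V : Finset (EuclideanSpace ℝ (Fin 2))) (n : ℕ) (hn : V.card = n) (h3 : 3 ≤ n)
    (P : Set (EuclideanSpace ℝ (Fin 2))) (hP : P = convexHull ℝ (V : Set (EuclideanSpace ℝ (Fin 2))))
    (hext : ∀ v ∈ V, v ∈ Set.extremePoints ℝ P)
    (hint : (interior P).Nonempty) :
    ∃ F : Finset (Finset (EuclideanSpace ℝ (Fin 2))),
      (∀ t ∈ F, t ⊆ V ∧ t.card = 3) ∧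
      (⋃ t ∈ F, convexHull ℝ (t : Set (EuclideanSpace ℝ (Fin 2)))) = P ∧
      (∀ t ∈ F, ∀ t' ∈ F, t ≠ t' →
        Disjoint (interior (convexHull ℝ (t : Set (EuclideanSpace ℝ (Fin 2)))))
          (interior (convexHull ℝ (t' : Set (EuclideanSpace ℝ (Fin 2)))))) ∧
      (∀ t ∈ F, ∀ p ∈ convexHull ℝ (t : Set (EuclideanSpace ℝ (Fin 2))),
        (infDist p (frontier P)) ^ 2
          ≤ (volume (convexHull ℝ (t : Set (EuclideanSpace ℝ (Fin 2))))).toReal) := by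
  classical
  subst hP
  obtain ⟨f, hf⟩ := exists_linearMap_injOn V
  have hcard : 1 < V.card := by omega
  have hne : V.Nonempty := Finset.card_pos.1 (by omega)
  obtain ⟨a, ha, hamin⟩ := V.exists_min_image f hne
  obtain ⟨b, hb, hbmax⟩ := V.exists_max_image f hne
  have hab : f a < f b := by
    obtain ⟨v, hv, hva⟩ := Finset.exists_mem_ne hcard a
    exact ((hamin v hv).lt_of_ne fun h => hva (hf hv ha h.symm)).trans_le (hbmax v hv)
  have hab' : a ≠ b := by rintro rfl; exact hab.false
  have hlo : ∀ x ∈ convexHull ℝ (V : Set ℝ²), f a ≤ f x := fun x hx =>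
    convexHull_min (fun v hv => hamin v hv) (convex_halfSpace_ge f.isLinear (f a)) hx
  have hhi : ∀ x ∈ convexHull ℝ (V : Set ℝ²), f x ≤ f b := fun x hx =>
    convexHull_min (fun v hv => hbmax v hv) (convex_halfSpace_le f.isLinear (f b)) hx
  obtain ⟨F, hF⟩ := exists_isCapTriangulation hext hf ha hb hab
    fun x hx _ => ⟨hlo x hx, hhi x hx⟩
  obtain ⟨G, hG⟩ := exists_isCapTriangulation (f := -f) hext
    (fun v hv w hw h => hf hv hw (neg_injective h)) hb ha (by simpa using hab)
    fun x hx _ => ⟨by simpa using hhi x hx, by simpa using hlo x hx⟩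
  have hFG : ∀ t ∈ F, ∀ t' ∈ G, Disjoint (interior (convexHull ℝ (t : Set ℝ²)))
      (interior (convexHull ℝ (t' : Set ℝ²))) := fun t ht t' ht' =>
    (disjoint_interior_of_orient hab' (fun x hx => by
      rw [orient_swap, neg_nonpos]
      exact hG.orient_nonneg t' ht' x hx) (hF.orient_nonneg t ht)).symm
  have hseg : ∀ x ∈ segment ℝ a b, ∃ t ∈ F ∪ G, x ∈ convexHull ℝ (t : Set ℝ²) := by
    intro x hx
    obtain ⟨v, hv, hv0⟩ := exists_orient_ne_zero hint hab'
    rcases hv0.lt_or_gt with h | h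
    · obtain ⟨t, ht, hxt⟩ := hG.cover_segment ⟨v, hv, by rw [orient_swap]; linarith⟩ x
        (segment_symm ℝ a b ▸ hx)
      exact ⟨t, Finset.mem_union_right _ ht, hxt⟩
    · obtain ⟨t, ht, hxt⟩ := hF.cover_segment ⟨v, hv, h⟩ x hx
      exact ⟨t, Finset.mem_union_left _ ht, hxt⟩
  refine ⟨F ∪ G, fun t ht => ?_, Set.Subset.antisymm ?_ ?_, fun t ht t' ht' htt' => ?_,
    fun t ht => ?_⟩
  · exact (Finset.mem_union.1 ht).elim (hF.subset_card t) (hG.subset_card t)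
  · exact Set.iUnion₂_subset fun t ht =>
      (Finset.mem_union.1 ht).elim hF.convexHull_subset hG.convexHull_subset
  · intro x hx
    simp only [Set.mem_iUnion, exists_prop]
    rcases le_total 0 (orient a b x) with h | h
    · rcases hF.cover x hx h with h | ⟨t, ht, h⟩
      · exact hseg x h
      · exact ⟨t, Finset.mem_union_left _ ht, h⟩
    · rcases hG.cover x hx (by rw [orient_swap]; linarith) with h | ⟨t, ht, h⟩
      · exact hseg x (segment_symm ℝ a b ▸ h)
      · exact ⟨t, Finset.mem_union_right _ ht, h⟩
  · rcases Finset.mem_union.1 ht with ht | ht <;> rcases Finset.mem_union.1 ht' with ht' | ht'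
    · exact hF.disjoint t ht t' ht' htt'
    · exact hFG t ht t' ht'
    · exact (hFG t' ht' t ht).symm
    · exact hG.disjoint t ht t' ht' htt'
  · exact (Finset.mem_union.1 ht).elim (hF.dist_sq_le t) (hG.dist_sq_le t)
end

section
/- Let ℓ > 0, h > 0 and 0 ≤ w ≤ ℓ. Let Q ⊆ [0,ℓ] × [0,h] ⊆ ℝ² be a set with (0,0) ∈ Q and (w,h) ∈ Q. Define Q₁ := {(x,y) ∈ Q : h·x ≤ w·y}, the part of Q lying on or above the line through (0,0) and (w,h). Then the Euclidean diameter of Q₁ equals dist((0,0),(w,h)) = √(w² + h²). (This is the invariant in the recursive triangulation of a convex polygon: after cutting off the triangle at the farthest vertex, the new subdivision edge realizes the diameter of the subpolygon it bounds.) -/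
open Metric

/-- Any two points of the rectangle `[0, w] × [0, h]` are at distance at most the length of its
diagonal. -/
theorem dist_le_sqrt_of_mem_rectangle {w h : ℝ} {p q : EuclideanSpace ℝ (Fin 2)}
    (hp₀ : p 0 ∈ Set.Icc 0 w) (hp₁ : p 1 ∈ Set.Icc 0 h)
    (hq₀ : q 0 ∈ Set.Icc 0 w) (hq₁ : q 1 ∈ Set.Icc 0 h) :
    dist p q ≤ Real.sqrt (w ^ 2 + h ^ 2) := by
  rw [EuclideanSpace.dist_eq, Fin.sum_univ_two]
  have h₀ : dist (p 0) (q 0) ≤ w := by simpa using Real.dist_le_of_mem_Icc hp₀ hq₀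
  have h₁ : dist (p 1) (q 1) ≤ h := by simpa using Real.dist_le_of_mem_Icc hp₁ hq₁
  gcongr

/-- After cutting a subpolygon `Q` (contained in an `ℓ × h` rectangle, with base corner
`(0,0)` and top vertex `(w,h)`) along the line through `(0,0)` and `(w,h)`, the part `Q₁`
on or above this line has diameter `dist ((0,0), (w,h)) = √(w² + h²)`. -/
theorem diam_of_upper_part_after_cut
    (ℓ h w : ℝ) (hℓ : 0 < ℓ) (hh : 0 < h) (hw0 : 0 ≤ w) (hwℓ : w ≤ ℓ)
    (Q : Set (EuclideanSpace ℝ (Fin 2)))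
    (hQ : Q ⊆ {p : EuclideanSpace ℝ (Fin 2) | p 0 ∈ Set.Icc 0 ℓ ∧ p 1 ∈ Set.Icc 0 h})
    (h00 : (WithLp.equiv 2 (Fin 2 → ℝ)).symm ![0, 0] ∈ Q)
    (hwh : (WithLp.equiv 2 (Fin 2 → ℝ)).symm ![w, h] ∈ Q)
    (Q₁ : Set (EuclideanSpace ℝ (Fin 2)))
    (hQ₁ : Q₁ = {p ∈ Q | h * p 0 ≤ w * p 1}) :
    diam Q₁ = dist ((WithLp.equiv 2 (Fin 2 → ℝ)).symm ![(0:ℝ), 0])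
        ((WithLp.equiv 2 (Fin 2 → ℝ)).symm ![w, h]) ∧
    diam Q₁ = Real.sqrt (w ^ 2 + h ^ 2) := by
  have mem_rectangle : ∀ p ∈ Q₁, p 0 ∈ Set.Icc 0 w ∧ p 1 ∈ Set.Icc 0 h := by
    intro p hp
    rw [hQ₁] at hp
    obtain ⟨hpQ, hline⟩ := hp
    obtain ⟨h₀, h₁⟩ := hQ hpQ
    refine ⟨⟨h₀.1, le_of_mul_le_mul_left ?_ hh⟩, h₁⟩
    calc h * p 0 ≤ w * p 1 := hline
      _ ≤ w * h := mul_le_mul_of_nonneg_left h₁.2 hw0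
      _ = h * w := mul_comm w h
  have dist_le : ∀ p ∈ Q₁, ∀ q ∈ Q₁, dist p q ≤ Real.sqrt (w ^ 2 + h ^ 2) := fun p hp q hq =>
    dist_le_sqrt_of_mem_rectangle (mem_rectangle p hp).1 (mem_rectangle p hp).2
      (mem_rectangle q hq).1 (mem_rectangle q hq).2
  have dist_corners : dist ((WithLp.equiv 2 (Fin 2 → ℝ)).symm ![(0:ℝ), 0])
      ((WithLp.equiv 2 (Fin 2 → ℝ)).symm ![w, h]) = Real.sqrt (w ^ 2 + h ^ 2) := by
    simp [EuclideanSpace.dist_eq, Fin.sum_univ_two, Real.dist_eq]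
  have h00' : (WithLp.equiv 2 (Fin 2 → ℝ)).symm ![0, 0] ∈ Q₁ := by
    rw [hQ₁]
    exact ⟨h00, by simp⟩
  have hwh' : (WithLp.equiv 2 (Fin 2 → ℝ)).symm ![w, h] ∈ Q₁ := by
    rw [hQ₁]
    exact ⟨hwh, by simp [mul_comm]⟩
  have diam_eq : diam Q₁ = Real.sqrt (w ^ 2 + h ^ 2) :=
    le_antisymm (diam_le_of_forall_dist_le (Real.sqrt_nonneg _) dist_le)
      (dist_corners ▸ dist_le_diam_of_mem (isBounded_iff.2 ⟨_, fun p hp q hq => dist_le p hp q hq⟩)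
        h00' hwh')
  exact ⟨diam_eq.trans dist_corners.symm, diam_eq⟩
end

section
/- Let ℓ > 0 and h > 0, and let Q ⊆ [0,ℓ] × [0,h] ⊆ ℝ² be a compact convex set with a := (0,0) ∈ Q, b := (ℓ,0) ∈ Q, and containing a point v ∈ Q whose second coordinate equals h. Let Γ := frontier Q \ {(x,0) : 0 < x < ℓ} be the boundary of Q with the open base segment removed. Then for every p ∈ Q one has infDist p Γ ≤ min(h, ℓ/2), and consequently (infDist p Γ)² ≤ h·ℓ/2 = area(convexHull ℝ {a, b, v}). -/
open Metric MeasureTheory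

/-- A ray from a point of a compact set `Q` has a last point in `Q`, which lies on the frontier. -/
theorem exists_last_mem_frontier {E : Type*} [NormedAddCommGroup E] [NormedSpace ℝ E]
    {Q : Set E} (hQ : IsCompact Q) {p u : E} (hp : p ∈ Q) (hu : u ≠ 0) :
    ∃ t : ℝ, 0 ≤ t ∧ p + t • u ∈ frontier Q ∧ ∀ s, p + s • u ∈ Q → s ≤ t := by
  have hemb : Topology.IsClosedEmbedding fun t : ℝ => p + t • u :=
    (Homeomorph.addLeft p).isClosedEmbedding.comp (isClosedEmbedding_smul_left hu)
  have h0 : (0 : ℝ) ∈ (fun t : ℝ => p + t • u) ⁻¹' Q := by simpa using hp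
  obtain ⟨t, htQ, ht⟩ := (hemb.isCompact_preimage hQ).exists_isGreatest ⟨0, h0⟩
  refine ⟨t, ht h0, ⟨subset_closure htQ, fun hint => ?_⟩, fun s hs => ht hs⟩
  have hev : ∀ᶠ s in nhds t, p + s • u ∈ Q :=
    hemb.continuous.continuousAt.eventually (mem_interior_iff_mem_nhds.1 hint)
  obtain ⟨s, hsQ, hts⟩ :=
    ((hev.filter_mono nhdsWithin_le_nhds).and (self_mem_nhdsWithin (s := Set.Ioi t))).exists
  exact (ht hsQ).not_gt hts

/-- A triangle with a base of length `ℓ` on the first axis, described by linear inequalities. -/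
theorem convexHull_triangle_eq {ℓ h : ℝ} (hℓ : 0 < ℓ) (hh : 0 < h)
    (v : EuclideanSpace ℝ (Fin 2)) (hv : v 1 = h) :
    convexHull ℝ {!₂[0, 0], !₂[ℓ, 0], v} =
      {p : EuclideanSpace ℝ (Fin 2) | 0 ≤ p 1 ∧ v 0 * p 1 ≤ h * p 0 ∧
        h * p 0 ≤ v 0 * p 1 + ℓ * (h - p 1)} := by
  apply Set.Subset.antisymm
  · apply convexHull_min
    · rintro p (rfl | rfl | rfl)
      · simp; positivity
      · simp; exact ⟨by positivity, by linarith⟩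
      · simp [hv, hh.le]; constructor <;> linarith
    · rintro p ⟨p1, p2, p3⟩ q ⟨q1, q2, q3⟩ s t hs ht hst
      obtain rfl : t = 1 - s := by linarith
      simp only [Set.mem_ofPred_eq, PiLp.add_apply, PiLp.smul_apply, smul_eq_mul]
      refine ⟨by positivity, ?_, ?_⟩
      · linarith [mul_le_mul_of_nonneg_left p2 hs, mul_le_mul_of_nonneg_left q2 ht]
      · linarith [mul_le_mul_of_nonneg_left p3 hs, mul_le_mul_of_nonneg_left q3 ht]
  · rintro p ⟨p1, p2, p3⟩
    have key := (convex_convexHull ℝ {!₂[0, 0], !₂[ℓ, 0], v}).sum_mem (t := Finset.univ)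
      (w := ![1 - p 1 / h - (h * p 0 - v 0 * p 1) / (h * ℓ),
        (h * p 0 - v 0 * p 1) / (h * ℓ), p 1 / h])
      (z := ![!₂[0, 0], !₂[ℓ, 0], v]) ?_ ?_ ?_
    · convert key using 1
      simp only [Fin.sum_univ_three]
      ext i
      fin_cases i
      · simp; field_simp; ring
      · simp [hv]; field_simp
    · intro i _
      fin_cases i
      · simp
        rw [one_sub_div hh.ne', div_le_div_iff₀ (by positivity) hh]
        nlinarith
      · exact div_nonneg (by linarith) (by positivity)
      · exact div_nonneg p1 hh.le
    · simp [Fin.sum_univ_three]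
    · intro i _
      apply subset_convexHull
      fin_cases i <;> simp

/-- The area of a triangle with base `ℓ` and height `h` is `h * ℓ / 2`. -/
theorem volume_convexHull_triangle {ℓ h : ℝ} (hℓ : 0 < ℓ) (hh : 0 < h)
    (v : EuclideanSpace ℝ (Fin 2)) (hv : v 1 = h) :
    volume (convexHull ℝ {!₂[0, 0], !₂[ℓ, 0], v}) = ENNReal.ofReal (h * ℓ / 2) := by
  set T : Set (ℝ × ℝ) := {q | 0 ≤ q.2 ∧ v 0 * q.2 ≤ h * q.1 ∧
        h * q.1 ≤ v 0 * q.2 + ℓ * (h - q.2)} with hT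
  have hTm : MeasurableSet T := by
    exact ((isClosed_le (f := fun _ => 0) (g := fun q : ℝ × ℝ => q.2)
      (by fun_prop) (by fun_prop)).inter
      ((isClosed_le (f := fun q : ℝ × ℝ => v 0 * q.2) (g := fun q => h * q.1)
      (by fun_prop) (by fun_prop)).inter
      (isClosed_le (f := fun q : ℝ × ℝ => h * q.1) (g := fun q => v 0 * q.2 + ℓ * (h - q.2))
      (by fun_prop) (by fun_prop)))).measurableSet
  have hslice (y : ℝ) : volume ((fun x => (x, y)) ⁻¹' T) =
      (Set.Icc 0 h).indicator (fun y => ENNReal.ofReal (ℓ * (1 - y / h))) y := by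
    by_cases hy : y ∈ Set.Icc 0 h
    · rw [Set.indicator_of_mem hy]
      have : (fun x => (x, y)) ⁻¹' T = Set.Icc (v 0 * y / h) ((v 0 * y + ℓ * (h - y)) / h) := by
        ext x
        simp only [hT, Set.mem_preimage, Set.mem_ofPred_eq, Set.mem_Icc, div_le_iff₀ hh,
          le_div_iff₀ hh, hy.1, true_and, mul_comm x]
      rw [this, Real.volume_Icc]
      congr 1
      field_simp
      ring
    · rw [Set.indicator_of_notMem hy]
      convert measure_empty (μ := volume)
      refine Set.eq_empty_of_forall_notMem ?_
      rintro x ⟨h1, h2, h3⟩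
      refine hy ⟨h1, ?_⟩
      simp only at h1 h2 h3
      nlinarith
  have hmp := (volume_preserving_finTwoArrow ℝ).comp
    (EuclideanSpace.volume_preserving_symm_measurableEquiv_toLp (Fin 2))
  have hpre : convexHull ℝ {!₂[0, 0], !₂[ℓ, 0], v} =
      (MeasurableEquiv.finTwoArrow ∘ (MeasurableEquiv.toLp 2 (Fin 2 → ℝ)).symm) ⁻¹' T :=
    (convexHull_triangle_eq hℓ hh v hv)
  rw [hpre, hmp.measure_preimage hTm.nullMeasurableSet, Measure.volume_eq_prod,
    Measure.prod_apply_symm hTm]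
  simp_rw [hslice]
  rw [lintegral_indicator measurableSet_Icc, ← ofReal_integral_eq_lintegral_ofReal]
  · rw [integral_Icc_eq_integral_Ioc, ← intervalIntegral.integral_of_le hh.le]
    congr 1
    simp
    field_simp
    norm_num
  · exact (by fun_prop : Continuous fun y : ℝ => ℓ * (1 - y / h)).continuousOn.integrableOn_Icc
  · refine (ae_restrict_mem measurableSet_Icc).mono fun y hy => ?_
    exact mul_nonneg hℓ.le (by rw [sub_nonneg, div_le_one hh]; exact hy.2)

/-- For a compact convex subpolygon `Q` in an `ℓ × h` rectangle with base corners
`a = (0,0)`, `b = (ℓ,0)` and a point `v` at height `h`, every point of `Q` is at distance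
at most `min h (ℓ/2)` from the boundary chain `Γ` (the boundary of `Q` minus the open base
segment), hence its squared distance is at most `h·ℓ/2 = area (triangle a b v)`. -/
theorem infDist_to_chain_sq_le_triangle_area
    (ℓ h : ℝ) (hℓ : 0 < ℓ) (hh : 0 < h)
    (Q : Set (EuclideanSpace ℝ (Fin 2))) (hQc : IsCompact Q) (hQconv : Convex ℝ Q)
    (hQ : Q ⊆ {p : EuclideanSpace ℝ (Fin 2) | p 0 ∈ Set.Icc 0 ℓ ∧ p 1 ∈ Set.Icc 0 h})
    (a b : EuclideanSpace ℝ (Fin 2))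
    (ha : a = (WithLp.equiv 2 (Fin 2 → ℝ)).symm ![0, 0])
    (hb : b = (WithLp.equiv 2 (Fin 2 → ℝ)).symm ![ℓ, 0])
    (haQ : a ∈ Q) (hbQ : b ∈ Q)
    (v : EuclideanSpace ℝ (Fin 2)) (hvQ : v ∈ Q) (hv : v 1 = h)
    (Γ : Set (EuclideanSpace ℝ (Fin 2)))
    (hΓ : Γ = frontier Q \ {p : EuclideanSpace ℝ (Fin 2) | 0 < p 0 ∧ p 0 < ℓ ∧ p 1 = 0}) :
    (∀ p ∈ Q, infDist p Γ ≤ min h (ℓ / 2)) ∧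
    (∀ p ∈ Q, (infDist p Γ) ^ 2 ≤ h * ℓ / 2) ∧
    (volume (convexHull ℝ ({a, b, v} : Set (EuclideanSpace ℝ (Fin 2))))).toReal = h * ℓ / 2 := by
  change a = !₂[0, 0] at ha
  change b = !₂[ℓ, 0] at hb
  subst ha hb
  have hray {p u : EuclideanSpace ℝ (Fin 2)} (hp : p ∈ Q) (hu : ‖u‖ = 1)
      (hbase : ∀ t : ℝ, 0 ≤ t → 0 < (p + t • u) 0 → (p + t • u) 0 < ℓ → (p + t • u) 1 = 0 →
        ∃ s > t, p + s • u ∈ Q) : ∃ t : ℝ, p + t • u ∈ Q ∧ infDist p Γ ≤ t := by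
    obtain ⟨t, ht0, htF, ht⟩ :=
      exists_last_mem_frontier hQc hp (norm_ne_zero_iff.1 (by simp [hu] : ‖u‖ ≠ 0))
    refine ⟨t, hQc.isClosed.frontier_subset htF, ?_⟩
    have hmem : p + t • u ∈ Γ := by
      rw [hΓ]
      refine ⟨htF, fun ⟨h1, h2, h3⟩ => ?_⟩
      obtain ⟨s, hst, hsQ⟩ := hbase t ht0 h1 h2 h3
      exact (ht s hsQ).not_gt hst
    simpa [norm_smul, hu, abs_of_nonneg ht0] using infDist_le_dist_of_mem (x := p) hmem
  have habove {x : ℝ} (hx0 : 0 < x) (hxℓ : x < ℓ) : ∃ y > 0, !₂[x, y] ∈ Q := by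
    rcases le_or_gt x (v 0) with hxv | hxv
    · have hv0 : 0 < v 0 := hx0.trans_le hxv
      refine ⟨x / v 0 * h, by positivity, ?_⟩
      convert hQconv haQ hvQ (sub_nonneg.2 ((div_le_one hv0).2 hxv))
        (div_nonneg hx0.le hv0.le) (sub_add_cancel _ _) using 1
      ext i
      fin_cases i
      · simp [hv0.ne']
      · simp [hv]
    · have hv0 : 0 < ℓ - v 0 := by linarith
      have hx : 0 < ℓ - x := by linarith
      refine ⟨(ℓ - x) / (ℓ - v 0) * h, by positivity, ?_⟩
      convert hQconv hbQ hvQ (sub_nonneg.2 ((div_le_one hv0).2 (by linarith)))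
        (div_nonneg hx.le hv0.le) (sub_add_cancel _ _) using 1
      ext i
      fin_cases i
      · simp; field_simp; ring
      · simp [hv]
  have hmin : ∀ p ∈ Q, infDist p Γ ≤ min h (ℓ / 2) := by
    intro p hp
    have hp' := hQ hp
    apply le_min
    · obtain ⟨t, htQ, ht⟩ := hray hp (u := !₂[0, 1]) (by simp [EuclideanSpace.norm_eq]) (by
        intro t ht0 h1 h2 h3
        obtain ⟨y, hy, hyQ⟩ := habove h1 h2
        refine ⟨y - p 1, ?_, ?_⟩
        · simp at h3 ⊢; linarith
        · convert hyQ using 1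
          ext i
          fin_cases i <;> simp)
      have := (hQ htQ).2.2
      have := hp'.2.1
      simp at *
      linarith
    · obtain ⟨t, htQ, ht⟩ := hray hp (u := !₂[-1, 0]) (by simp [EuclideanSpace.norm_eq]) (by
        intro t ht0 h1 h2 h3
        refine ⟨p 0, by simp at h1 ⊢; linarith, ?_⟩
        convert haQ using 1
        ext i
        fin_cases i
        · simp
        · simpa using h3)
      obtain ⟨s, hsQ, hs⟩ := hray hp (u := !₂[1, 0]) (by simp [EuclideanSpace.norm_eq]) (by
        intro t ht0 h1 h2 h3
        refine ⟨ℓ - p 0, by simp at h2 ⊢; linarith, ?_⟩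
        convert hbQ using 1
        ext i
        fin_cases i
        · simp
        · simpa using h3)
      have := (hQ htQ).1.1
      have := (hQ hsQ).1.2
      simp at *
      linarith
  refine ⟨hmin, fun p hp => ?_, ?_⟩
  · have h1 := (hmin p hp).trans (min_le_left _ _)
    have h2 := (hmin p hp).trans (min_le_right _ _)
    calc infDist p Γ ^ 2 = infDist p Γ * infDist p Γ := sq _
      _ ≤ h * (ℓ / 2) := mul_le_mul h1 h2 infDist_nonneg hh.le
      _ = h * ℓ / 2 := by ring
  · rw [volume_convexHull_triangle hℓ hh v hv, ENNReal.toReal_ofReal (by positivity)]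
end

section
/- Let B ⊆ ℝ² and let C ⊆ ℝ² be a set with the following property: for every p ∈ C there exist a point (a₁, a₂) ∈ ℝ² and a real s > 0 such that p lies in the closed axis-aligned square [a₁, a₁+s] × [a₂, a₂+s], this square is contained in C, and the square contains at least one point of B. Then for every p ∈ C one has (infDist p B)² ≤ 2 · area(C), where the inequality is interpreted in the extended nonnegative reals (so it is automatic when area(C) = ∞). (This is the area bound for the regions produced by the square-pushing construction: each region is a union of squares touching the polygon boundary, hence its area is at least half the squared distance from any of its points to the boundary.) -/
open Metric MeasureTheory

/-- The area of an axis-aligned square of side `s` in the Euclidean plane is `s ^ 2`. -/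
lemma volume_axisAlignedSquare (a₁ a₂ : ℝ) {s : ℝ} (hs : 0 ≤ s) :
    volume {q : EuclideanSpace ℝ (Fin 2) |
      q 0 ∈ Set.Icc a₁ (a₁ + s) ∧ q 1 ∈ Set.Icc a₂ (a₂ + s)} = ENNReal.ofReal (s ^ 2) := by
  have h : {q : EuclideanSpace ℝ (Fin 2) |
      q 0 ∈ Set.Icc a₁ (a₁ + s) ∧ q 1 ∈ Set.Icc a₂ (a₂ + s)} =
      WithLp.ofLp ⁻¹' Set.Icc ![a₁, a₂] ![a₁ + s, a₂ + s] := by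
    ext q
    simp [Pi.le_def, Fin.forall_fin_two, and_and_and_comm]
  rw [h, (PiLp.volume_preserving_ofLp (Fin 2)).measure_preimage
    measurableSet_Icc.nullMeasurableSet, Real.volume_Icc_pi]
  simp [Fin.prod_univ_two, ← ENNReal.ofReal_mul hs, pow_two]

/-- Two points of an axis-aligned square of side `s` are at squared distance at most `2 * s ^ 2`. -/
lemma sq_dist_le_of_mem_axisAlignedSquare {a₁ a₂ s : ℝ} {p q : EuclideanSpace ℝ (Fin 2)}
    (hp : p 0 ∈ Set.Icc a₁ (a₁ + s) ∧ p 1 ∈ Set.Icc a₂ (a₂ + s))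
    (hq : q 0 ∈ Set.Icc a₁ (a₁ + s) ∧ q 1 ∈ Set.Icc a₂ (a₂ + s)) :
    dist p q ^ 2 ≤ 2 * s ^ 2 := by
  have h₀ := Real.dist_le_of_mem_Icc hp.1 hq.1
  have h₁ := Real.dist_le_of_mem_Icc hp.2 hq.2
  rw [add_sub_cancel_left] at h₀ h₁
  rw [EuclideanSpace.dist_sq_eq, Fin.sum_univ_two, two_mul]
  gcongr

/-- If every point of a region `C` lies in some closed axis-aligned square that is contained
in `C` and touches the set `B`, then for every `p ∈ C` the squared distance from `p` to `B`
is at most twice the area of `C` (in the extended nonnegative reals). -/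
theorem sq_infDist_le_two_mul_area_of_squares_touching_boundary
    (B C : Set (EuclideanSpace ℝ (Fin 2)))
    (hC : ∀ p ∈ C, ∃ (a₁ a₂ s : ℝ), 0 < s ∧
      p ∈ {q : EuclideanSpace ℝ (Fin 2) |
            q 0 ∈ Set.Icc a₁ (a₁ + s) ∧ q 1 ∈ Set.Icc a₂ (a₂ + s)} ∧
      {q : EuclideanSpace ℝ (Fin 2) |
            q 0 ∈ Set.Icc a₁ (a₁ + s) ∧ q 1 ∈ Set.Icc a₂ (a₂ + s)} ⊆ C ∧
      ({q : EuclideanSpace ℝ (Fin 2) |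
            q 0 ∈ Set.Icc a₁ (a₁ + s) ∧ q 1 ∈ Set.Icc a₂ (a₂ + s)} ∩ B).Nonempty) :
    ∀ p ∈ C, ENNReal.ofReal ((infDist p B) ^ 2) ≤ 2 * volume C := by
  intro p hp
  obtain ⟨a₁, a₂, s, hs, hpS, hSC, q, hqS, hqB⟩ := hC p hp
  have hdist : infDist p B ^ 2 ≤ 2 * s ^ 2 :=
    (pow_le_pow_left₀ infDist_nonneg (infDist_le_dist_of_mem hqB) 2).trans
      (sq_dist_le_of_mem_axisAlignedSquare hpS hqS)
  calc ENNReal.ofReal (infDist p B ^ 2)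
      ≤ ENNReal.ofReal (2 * s ^ 2) := ENNReal.ofReal_le_ofReal hdist
    _ = 2 * ENNReal.ofReal (s ^ 2) := by
      rw [ENNReal.ofReal_mul zero_le_two, ENNReal.ofReal_ofNat]
    _ ≤ 2 * volume C := by
      rw [← volume_axisAlignedSquare a₁ a₂ hs.le]
      gcongr
end

section
/- Let K ⊆ ℝ² be a compact convex set with positive area whose set of extreme points is finite with n elements. Then there exist a nonzero vector u ∈ ℝ² and a real number c such that area(K ∩ {x : ⟪u,x⟫ ≤ c}) = area(K)/2, at most ⌊n/2⌋ extreme points of K satisfy ⟪u,x⟫ < c, and at most ⌊n/2⌋ extreme points of K satisfy ⟪u,x⟫ > c. (A line simultaneously bisecting the area of a convex polygon and leaving at most half of its vertices strictly on each side.) -/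
open Metric MeasureTheory RealInnerProductSpace

section HalfSpaces

variable {E : Type*} [NormedAddCommGroup E] [InnerProductSpace ℝ E]

theorem measurableSet_inner_le [MeasurableSpace E] [BorelSpace E] (u : E) (c : ℝ) :
    MeasurableSet {x : E | ⟪u, x⟫ ≤ c} :=
  (isClosed_le (by fun_prop) continuous_const).measurableSet

variable [FiniteDimensional ℝ E] [MeasurableSpace E] [BorelSpace E]

/-- Affine hyperplanes are null sets. -/
theorem volume_inner_eq_zero {u : E} (hu : u ≠ 0) (c : ℝ) :
    volume {x : E | ⟪u, x⟫ = c} = 0 := by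
  have hs : AffineSubspace.mk' ((c / ⟪u, u⟫) • u) (LinearMap.ker (innerₛₗ ℝ u)) ≠ ⊤ := by
    intro h
    have := congrArg AffineSubspace.direction h
    rw [AffineSubspace.direction_mk', AffineSubspace.direction_top] at this
    have hmem : u ∈ LinearMap.ker (innerₛₗ ℝ u) := this ▸ Submodule.mem_top
    simp [hu] at hmem
  refine measure_mono_null ?_ (Measure.addHaar_affineSubspace volume _ hs)
  intro x hx
  have hx : ⟪u, x⟫ = c := hx
  have huu : ⟪u, u⟫ ≠ 0 := inner_self_ne_zero.mpr hu
  simp only [SetLike.mem_coe, AffineSubspace.mem_mk', vsub_eq_sub, LinearMap.mem_ker,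
    innerₛₗ_apply_apply, inner_sub_right, inner_smul_right, hx]
  field_simp
  ring

/-- The volume of the part of a set cut off by a half-space depends continuously on the
half-space. -/
theorem continuousAt_measureReal_inter_inner_le {K : Set E} (hK : volume K ≠ ⊤)
    {p : E × ℝ} (hp : p.1 ≠ 0) :
    ContinuousAt (fun q : E × ℝ => volume.real (K ∩ {x | ⟪q.1, x⟫ ≤ q.2})) p := by
  have : IsFiniteMeasure (volume.restrict K) := ⟨by simpa using hK.lt_top⟩
  have key : (fun q : E × ℝ => volume.real (K ∩ {x | ⟪q.1, x⟫ ≤ q.2})) =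
      fun q => ∫ x in K, {x | ⟪q.1, x⟫ ≤ q.2}.indicator (fun _ => (1 : ℝ)) x := by
    funext q
    rw [integral_indicator (measurableSet_inner_le _ _)]
    simp [measureReal_restrict_apply (measurableSet_inner_le _ _), Set.inter_comm]
  rw [key]
  refine continuousAt_of_dominated (bound := fun _ => 1) ?_ ?_ (integrable_const _) ?_
  · exact .of_forall fun q =>
      (measurable_const.indicator (measurableSet_inner_le _ _)).aestronglyMeasurable
  · refine .of_forall fun q => .of_forall fun x => ?_
    by_cases h : ⟪q.1, x⟫ ≤ q.2 <;> simp [h]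
  · have hae : ∀ᵐ x ∂(volume.restrict K), ⟪p.1, x⟫ ≠ p.2 :=
      ae_restrict_of_ae (measure_eq_zero_iff_ae_notMem.mp (volume_inner_eq_zero hp p.2))
    filter_upwards [hae] with x hx
    have h1 : Continuous fun q : E × ℝ => ⟪q.1, x⟫ := by fun_prop
    rcases hx.lt_or_gt with h | h
    · refine (continuousAt_const (y := (1 : ℝ))).congr ?_
      filter_upwards [h1.continuousAt.eventually_lt continuous_snd.continuousAt h] with q hq
      simp [hq.le]
    · refine (continuousAt_const (y := (0 : ℝ))).congr ?_
      filter_upwards [continuous_snd.continuousAt.eventually_lt h1.continuousAt h] with q hq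
      simp [hq]

theorem measureReal_inter_inner_neg_le {K : Set E} (hK : volume K ≠ ⊤) {u : E} (hu : u ≠ 0)
    (c : ℝ) :
    volume.real (K ∩ {x | ⟪-u, x⟫ ≤ -c}) =
      volume.real K - volume.real (K ∩ {x | ⟪u, x⟫ ≤ c}) := by
  rw [← measureReal_inter_add_sdiff (s := K) (measurableSet_inner_le u c) hK, add_sub_cancel_left]
  refine measureReal_congr ?_
  filter_upwards [measure_eq_zero_iff_ae_notMem.mp (volume_inner_eq_zero hu c)] with x hx
  refine propext (and_congr_right fun _ => ?_)
  have hx : ⟪u, x⟫ ≠ c := hx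
  change ⟪-u, x⟫ ≤ -c ↔ ¬ ⟪u, x⟫ ≤ c
  rw [inner_neg_left, neg_le_neg_iff, not_le, le_iff_lt_or_eq]
  simp [hx.symm]

/-- Strict monotonicity of the volume cut off from a convex set by parallel half-spaces, as long
as both parts have positive volume. -/
theorem measureReal_inter_inner_le_lt {K : Set E} (hK : volume K ≠ ⊤) (hconv : Convex ℝ K)
    {u : E} {a b : ℝ} (hab : a < b)
    (ha : 0 < volume.real (K ∩ {x | ⟪u, x⟫ ≤ a}))
    (hb : volume.real (K ∩ {x | ⟪u, x⟫ ≤ b}) < volume.real K) :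
    volume.real (K ∩ {x | ⟪u, x⟫ ≤ a}) < volume.real (K ∩ {x | ⟪u, x⟫ ≤ b}) := by
  have hint : interior K =ᵐ[volume] K :=
    interior_ae_eq_of_null_frontier (hconv.addHaar_frontier volume)
  obtain ⟨x, hxK, hxa⟩ : (interior K ∩ {x | ⟪u, x⟫ ≤ a}).Nonempty := by
    refine Set.nonempty_iff_ne_empty.mpr fun h => ha.ne' ?_
    rw [← measureReal_congr (hint.inter (ae_eq_refl {x | ⟪u, x⟫ ≤ a})), h, measureReal_empty]
  obtain ⟨y, hyK, hyb⟩ : (interior K \ {x | ⟪u, x⟫ ≤ b}).Nonempty := by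
    refine Set.nonempty_iff_ne_empty.mpr fun h => hb.ne ?_
    have h0 : volume.real (K \ {x | ⟪u, x⟫ ≤ b}) = 0 := by
      rw [← measureReal_congr (hint.diff (ae_eq_refl {x | ⟪u, x⟫ ≤ b})), h, measureReal_empty]
    rw [← measureReal_inter_add_sdiff (s := K) (measurableSet_inner_le u b) hK, h0, add_zero]
  have hxa : ⟪u, x⟫ ≤ a := hxa
  have hyb : b < ⟪u, y⟫ := not_le.mp hyb
  have hcont : Continuous fun z : E => ⟪u, z⟫ := by fun_prop
  obtain ⟨z, hzK, hz⟩ := hconv.interior.isPreconnected.intermediate_value hxK hyK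
    hcont.continuousOn (show (a + b) / 2 ∈ _ from ⟨by linarith, by linarith⟩)
  have hz : ⟪u, z⟫ = (a + b) / 2 := hz
  set U : Set E := interior K ∩ {w | a < ⟪u, w⟫ ∧ ⟪u, w⟫ < b}
  have hUo : IsOpen U := isOpen_interior.inter
    ((isOpen_lt continuous_const hcont).inter (isOpen_lt hcont continuous_const))
  have hU : 0 < volume U :=
    hUo.measure_pos _ ⟨z, hzK, by linarith, by linarith⟩
  have hUK : U ⊆ K := fun w hw => interior_subset hw.1
  have hUr : 0 < volume.real U :=
    ENNReal.toReal_pos hU.ne' (measure_ne_top_of_subset hUK hK)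
  have hdisj : Disjoint (K ∩ {x | ⟪u, x⟫ ≤ a}) U :=
    Set.disjoint_left.mpr fun w hw hw' => (hw.2 : ⟪u, w⟫ ≤ a).not_gt hw'.2.1
  have hsub : (K ∩ {x | ⟪u, x⟫ ≤ a}) ∪ U ⊆ K ∩ {x | ⟪u, x⟫ ≤ b} := by
    rintro w (hw | hw)
    · exact ⟨hw.1, (hw.2 : ⟪u, w⟫ ≤ a).trans hab.le⟩
    · exact ⟨hUK hw, hw.2.2.le⟩
  have hle := measureReal_mono (μ := volume) hsub
    (measure_ne_top_of_subset Set.inter_subset_left hK)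
  rw [measureReal_union hdisj hUo.measurableSet
    (measure_ne_top_of_subset Set.inter_subset_left hK) (measure_ne_top_of_subset hUK hK)] at hle
  linarith

theorem exists_measureReal_inter_inner_le_eq_half {K : Set E} (hK : IsCompact K)
    {u : E} (hu : u ≠ 0) :
    ∃ c : ℝ, volume.real (K ∩ {x | ⟪u, x⟫ ≤ c}) = volume.real K / 2 := by
  have hcont : Continuous fun c : ℝ => volume.real (K ∩ {x | ⟪u, x⟫ ≤ c}) :=
    continuous_iff_continuousAt.mpr fun c =>
      ContinuousAt.comp (f := fun c : ℝ => (u, c))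
        (continuousAt_measureReal_inter_inner_le hK.measure_lt_top.ne hu) (by fun_prop)
  have hbdd := hK.image (f := fun x : E => ⟪u, x⟫) (by fun_prop)
  obtain ⟨M, hM⟩ := hbdd.bddAbove
  obtain ⟨m, hm⟩ := hbdd.bddBelow
  have hlow : K ∩ {x | ⟪u, x⟫ ≤ m - 1} = ∅ := by
    ext x
    simp only [Set.mem_inter_iff, Set.mem_ofPred_eq, Set.mem_empty_iff_false, iff_false]
    rintro ⟨hx, hle⟩
    linarith [hm (Set.mem_image_of_mem _ hx)]
  have hhigh : K ∩ {x | ⟪u, x⟫ ≤ M} = K :=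
    Set.inter_eq_left.mpr fun x hx => hM (Set.mem_image_of_mem _ hx)
  refine mem_range_of_exists_le_of_exists_ge hcont ⟨m - 1, ?_⟩ ⟨M, ?_⟩
  · rw [hlow, measureReal_empty]
    positivity
  · rw [hhigh]
    linarith [measureReal_nonneg (μ := volume) (s := K)]

end HalfSpaces

/-- For finitely many functions, strict upper bounds holding for at least `m` of them persist. -/
theorem isOpen_lt_ncard_setOf_lt {X ι : Type*} [TopologicalSpace X] {P : Set ι} (hP : P.Finite)
    {f : ι → X → ℝ} (hf : ∀ i, Continuous (f i)) (a : ℝ) (m : ℕ) :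
    IsOpen {x | m < {i ∈ P | f i x < a}.ncard} := by
  refine isOpen_iff_mem_nhds.mpr fun x hx => ?_
  have hfin : {i ∈ P | f i x < a}.Finite := hP.subset (Set.sep_subset _ _)
  have hev : ∀ᶠ y in nhds x, ∀ i ∈ {i ∈ P | f i x < a}, f i y < a :=
    (Filter.eventually_all_finite hfin).mpr fun i hi =>
      (hf i).continuousAt.eventually_lt_const hi.2
  filter_upwards [hev] with y hy
  exact lt_of_lt_of_le hx (Set.ncard_le_ncard (fun i hi => ⟨hi.1, hy i hi⟩)
    (hP.subset (Set.sep_subset _ _)))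

/-- A discrete Borsuk-Ulam argument: finitely many odd continuous functions on a connected space
with an involution have a point where at most half of them are negative and at most half of them
are positive. -/
theorem exists_ncard_neg_le_half_and_ncard_pos_le_half {X ι : Type*} [TopologicalSpace X]
    [ConnectedSpace X] (σ : X → X) {P : Set ι} (hP : P.Finite) {f : ι → X → ℝ}
    (hf : ∀ i, Continuous (f i)) (hσ : ∀ i x, f i (σ x) = -f i x) :
    ∃ x, {i ∈ P | f i x < 0}.ncard ≤ P.ncard / 2 ∧ {i ∈ P | 0 < f i x}.ncard ≤ P.ncard / 2 := by
  by_contra! h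
  set L := {x | P.ncard / 2 < {i ∈ P | f i x < 0}.ncard} with hL
  set R := {x | P.ncard / 2 < {i ∈ P | 0 < f i x}.ncard} with hR
  have hLo : IsOpen L := isOpen_lt_ncard_setOf_lt hP hf 0 _
  have hRo : IsOpen R := by
    simpa using isOpen_lt_ncard_setOf_lt hP (fun i => (hf i).neg) 0 (P.ncard / 2)
  have hcover : ∀ x, x ∈ L ∨ x ∈ R := fun x => by
    by_cases hx : x ∈ L
    · exact .inl hx
    · exact .inr (h x (not_lt.mp hx))
  have hLR : ∀ x, x ∈ L → σ x ∈ R := fun x hx => by simpa [hL, hR, hσ] using hx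
  have hRL : ∀ x, x ∈ R → σ x ∈ L := fun x hx => by simpa [hL, hR, hσ] using hx
  obtain ⟨x⟩ := (inferInstance : Nonempty X)
  have hne : L.Nonempty ∧ R.Nonempty := by
    rcases hcover x with hx | hx
    · exact ⟨⟨x, hx⟩, ⟨_, hLR x hx⟩⟩
    · exact ⟨⟨_, hRL x hx⟩, ⟨x, hx⟩⟩
  obtain ⟨y, -, hyL, hyR⟩ := isPreconnected_univ L R hLo hRo (fun x _ => hcover x)
    (by simpa using hne.1) (by simpa using hne.2)
  have hdisj : Disjoint {i ∈ P | f i y < 0} {i ∈ P | 0 < f i y} :=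
    Set.disjoint_left.mpr fun i hi hi' => lt_asymm hi.2 hi'.2
  have hsum := Set.ncard_union_eq hdisj (hP.subset (Set.sep_subset _ _))
    (hP.subset (Set.sep_subset _ _))
  have hle := Set.ncard_le_ncard
    (Set.union_subset (Set.sep_subset P (fun i => f i y < 0)) (Set.sep_subset P (fun i => 0 < f i y)))
    hP
  have hyL : P.ncard / 2 < {i ∈ P | f i y < 0}.ncard := hyL
  have hyR : P.ncard / 2 < {i ∈ P | 0 < f i y}.ncard := hyR
  omega

/-- A line simultaneously bisecting the area of a convex polygon and leaving at most half of
its vertices strictly on each side. -/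
theorem exists_area_bisecting_halving_line
    (K : Set (EuclideanSpace ℝ (Fin 2))) (hKc : IsCompact K) (hKconv : Convex ℝ K)
    (hpos : 0 < volume K) (n : ℕ)
    (hfin : (Set.extremePoints ℝ K).Finite)
    (hn : (Set.extremePoints ℝ K).ncard = n) :
    ∃ (u : EuclideanSpace ℝ (Fin 2)) (c : ℝ), u ≠ 0 ∧
      volume (K ∩ {x : EuclideanSpace ℝ (Fin 2) | ⟪u, x⟫ ≤ c}) = volume K / 2 ∧
      ({x ∈ Set.extremePoints ℝ K | ⟪u, x⟫ < c}).ncard ≤ n / 2 ∧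
      ({x ∈ Set.extremePoints ℝ K | c < ⟪u, x⟫}).ncard ≤ n / 2 := by
  subst hn
  have hK : volume K ≠ ⊤ := hKc.measure_lt_top.ne
  have hV : 0 < volume.real K := ENNReal.toReal_pos hpos.ne' hK
  have : ConnectedSpace ↥({0}ᶜ : Set (EuclideanSpace ℝ (Fin 2))) :=
    Subtype.connectedSpace (isConnected_compl_singleton_of_one_lt_rank
      (by rw [← Module.finrank_eq_rank, finrank_euclideanSpace_fin]; norm_num) 0)
  obtain ⟨⟨u, hu⟩, hneg, hpos'⟩ := exists_ncard_neg_le_half_and_ncard_pos_le_half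
    (X := ↥({0}ᶜ : Set (EuclideanSpace ℝ (Fin 2))))
    (fun u => ⟨-u.1, neg_ne_zero.mpr u.2⟩) hfin
    (f := fun v u => volume.real (K ∩ {x | ⟪u.1, x⟫ ≤ ⟪u.1, v⟫}) - volume.real K / 2)
    (fun v => (continuous_iff_continuousAt.mpr fun u =>
      ContinuousAt.comp (f := fun u : ↥({0}ᶜ : Set (EuclideanSpace ℝ (Fin 2))) => (u.1, ⟪u.1, v⟫))
        (continuousAt_measureReal_inter_inner_le hK u.2) (by fun_prop)).sub continuous_const)
    (fun v u => by
      simp only [inner_neg_left u.1 v, measureReal_inter_inner_neg_le hK u.2]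
      ring)
  have hu : u ≠ 0 := hu
  obtain ⟨c, hc⟩ := exists_measureReal_inter_inner_le_eq_half hKc hu
  have hlt : ∀ {a b : ℝ}, a < b → (a = c ∨ b = c) →
      volume.real (K ∩ {x | ⟪u, x⟫ ≤ a}) < volume.real (K ∩ {x | ⟪u, x⟫ ≤ b}) := by
    intro a b hab habc
    by_contra! hle
    refine hle.not_gt (measureReal_inter_inner_le_lt hK hKconv hab ?_ ?_) <;>
      rcases habc with rfl | rfl <;> linarith
  refine ⟨u, c, hu, ?_, ?_, ?_⟩
  · rw [← ENNReal.toReal_eq_toReal_iff' (measure_ne_top_of_subset Set.inter_subset_left hK)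
      (ENNReal.div_ne_top hK two_ne_zero), ENNReal.toReal_div]
    exact hc
  · refine le_trans (Set.ncard_le_ncard ?_ (hfin.subset (Set.sep_subset _ _))) hneg
    exact fun x hx => ⟨hx.1, by linarith [hlt hx.2 (.inr rfl)]⟩
  · refine le_trans (Set.ncard_le_ncard ?_ (hfin.subset (Set.sep_subset _ _))) hpos'
    exact fun x hx => ⟨hx.1, by linarith [hlt hx.2 (.inl rfl)]⟩
end

section
/- Let K ⊆ ℝ² be a compact convex set with positive area whose set of extreme points is finite with n elements. Then there exist a nonzero vector u ∈ ℝ² and a real number c such that, setting K₁ := K ∩ {x : ⟪u,x⟫ ≤ c} and K₂ := K ∩ {x : ⟪u,x⟫ ≥ c}, one has area(K₁) = area(K₂) = area(K)/2 and each of K₁ and K₂ has at most ⌊n/2⌋ + 2 extreme points. -/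
open Metric MeasureTheory RealInnerProductSpace

open Set Filter Topology Module

section ExtremePoints

variable {E : Type*} [NormedAddCommGroup E] [InnerProductSpace ℝ E]

/-- A collinear set of extreme points has at most two elements. -/
lemma encard_le_two_of_collinear_of_subset_extremePoints {A S : Set E}
    (hS : Collinear ℝ S) (hSA : S ⊆ A.extremePoints ℝ) : S.encard ≤ 2 := by
  by_contra! h
  obtain ⟨T, hTS, hT⟩ := exists_subset_encard_eq (k := 3) (s := S)
    (by simpa using! Order.add_one_le_of_lt h)
  obtain ⟨x, y, z, hxy, hxz, hyz, rfl⟩ := encard_eq_three.1 hT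
  have key : ∀ ⦃a b c : E⦄, a ∈ S → b ∈ S → c ∈ S → Wbtw ℝ a b c → a = b ∨ c = b :=
    fun a b c ha hb hc h ↦ (mem_extremePoints_iff_forall_segment.1 (hSA hb)).2 a (hSA ha).1 c
      (hSA hc).1 (mem_segment_iff_wbtw.2 h)
  have hx : x ∈ S := hTS (by simp)
  have hy : y ∈ S := hTS (by simp)
  have hz : z ∈ S := hTS (by simp)
  rcases (hS.subset hTS).wbtw_or_wbtw_or_wbtw with h | h | h
  · rcases key hx hy hz h with h | h <;> simp_all
  · rcases key hy hz hx h with h | h <;> simp_all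
  · rcases key hz hx hy h with h | h <;> simp_all

/-- In the plane, the level sets of a nonzero linear functional are collinear. -/
lemma collinear_setOf_inner_eq [Fact (finrank ℝ E = 2)] {u : E} (hu : u ≠ 0) (c : ℝ) :
    Collinear ℝ {x : E | ⟪u, x⟫ = c} := by
  have : FiniteDimensional ℝ E := .of_fact_finrank_eq_succ 1
  have : Fact (finrank ℝ E = 1 + 1) := ‹Fact (finrank ℝ E = 2)›
  rw [collinear_iff_finrank_le_one]
  refine (Submodule.finrank_mono (t := (ℝ ∙ u)ᗮ) ?_).trans
    (Submodule.finrank_orthogonal_span_singleton (n := 1) hu).le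
  refine Submodule.span_le.2 ?_
  rintro _ ⟨x, hx, y, hy, rfl⟩
  simp only [mem_ofPred_eq] at hx hy
  simp [Submodule.mem_orthogonal_singleton_iff_inner_right, inner_sub_right, hx, hy]

/-- Being an extreme point is a local property: it is not affected by cutting with a half-space
that contains the point in its interior. -/
lemma mem_extremePoints_of_mem_extremePoints_inter_halfSpace {K : Set E} (hK : Convex ℝ K)
    {u x : E} {c : ℝ} (hx : x ∈ (K ∩ {x | ⟪u, x⟫ ≤ c}).extremePoints ℝ) (hxc : ⟪u, x⟫ < c) :
    x ∈ K.extremePoints ℝ := by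
  refine ⟨hx.1.1, fun y hy z hz hxyz ↦ ?_⟩
  have near : ∀ w : E, ∀ᶠ t in 𝓝[>] (0 : ℝ), ⟪u, x + t • (w - x)⟫ < c := fun w ↦ by
    have : Continuous fun t : ℝ ↦ ⟪u, x + t • (w - x)⟫ := by fun_prop
    exact (this.tendsto 0).mono_left nhdsWithin_le_nhds |>.eventually_lt_const (by simpa)
  obtain ⟨t, ⟨⟨hty, htz⟩, ht1⟩, ht0⟩ := (((near y).and (near z)).and
    (nhdsWithin_le_nhds (eventually_lt_nhds (zero_lt_one' ℝ)))).and self_mem_nhdsWithin |>.exists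
  have mem : ∀ w ∈ K, x + t • (w - x) ∈ K := fun w hw ↦
    hK.add_smul_sub_mem hx.1.1 hw ⟨ht0.le, ht1.le⟩
  obtain ⟨a, b, ha, hb, hab, hxe⟩ := hxyz
  have h := hx.2 ⟨mem y hy, hty.le⟩ ⟨mem z hz, htz.le⟩ ⟨a, b, ha, hb, hab, by
    calc a • (x + t • (y - x)) + b • (x + t • (z - x))
        = (a + b) • x + t • ((a • y + b • z) - (a + b) • x) := by module
      _ = x := by rw [hab, hxe]; simp⟩
  have ht0' : t ≠ 0 := ht0.ne'
  simpa [ht0', sub_eq_zero] using h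

/-- Cutting a planar convex set by a half-plane creates at most two extreme points besides those
in the open half-plane. -/
lemma encard_extremePoints_inter_halfSpace_le [Fact (finrank ℝ E = 2)] {K : Set E}
    (hK : Convex ℝ K) {u : E} (hu : u ≠ 0) (c : ℝ) :
    ((K ∩ {x | ⟪u, x⟫ ≤ c}).extremePoints ℝ).encard ≤
      {x ∈ K.extremePoints ℝ | ⟪u, x⟫ < c}.encard + 2 := by
  set P := (K ∩ {x | ⟪u, x⟫ ≤ c}).extremePoints ℝ
  have hsub : P ⊆ {x ∈ K.extremePoints ℝ | ⟪u, x⟫ < c} ∪ (P ∩ {x | ⟪u, x⟫ = c}) := fun x hx ↦ by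
    rcases (show ⟪u, x⟫ ≤ c from hx.1.2).lt_or_eq with h | h
    · exact .inl ⟨mem_extremePoints_of_mem_extremePoints_inter_halfSpace hK hx h, h⟩
    · exact .inr ⟨hx, h⟩
  refine (encard_le_encard hsub).trans ((encard_union_le _ _).trans ?_)
  gcongr
  exact encard_le_two_of_collinear_of_subset_extremePoints
    ((collinear_setOf_inner_eq hu c).subset inter_subset_right) inter_subset_left

end ExtremePoints

section HalfSpaceMeasure

variable {E : Type*} [NormedAddCommGroup E] [InnerProductSpace ℝ E] [FiniteDimensional ℝ E]
  [MeasurableSpace E] [BorelSpace E] (μ : Measure E) [μ.IsAddHaarMeasure] {K : Set E}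

lemma addHaar_setOf_inner_eq {u : E} (hu : u ≠ 0) (c : ℝ) : μ {x | ⟪u, x⟫ = c} = 0 := by
  rcases {x : E | ⟪u, x⟫ = c}.eq_empty_or_nonempty with h | ⟨p, hp⟩
  · simp [h]
  have mem_iff : ∀ x, x ∈ AffineSubspace.mk' p (ℝ ∙ u)ᗮ ↔ ⟪u, x⟫ = c := fun x ↦ by
    rw [AffineSubspace.mem_mk', Submodule.mem_orthogonal_singleton_iff_inner_right, vsub_eq_sub,
      inner_sub_right, sub_eq_zero, show ⟪u, p⟫ = c from hp]
  refine measure_mono_null (fun x hx ↦ (mem_iff x).2 hx)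
    (Measure.addHaar_affineSubspace μ (AffineSubspace.mk' p (ℝ ∙ u)ᗮ) fun h ↦ ?_)
  have := (mem_iff (p + u)).1 (h ▸ AffineSubspace.mem_top ℝ E _)
  rw [inner_add_right, show ⟪u, p⟫ = c from hp] at this
  simp_all

lemma tendsto_measureReal_inter_halfSpace {α : Type*} {l : Filter α} [l.IsCountablyGenerated]
    (hK : IsCompact K) {u : α → E} {c : α → ℝ} {u₀ : E} {c₀ : ℝ} (hu₀ : u₀ ≠ 0)
    (hu : Tendsto u l (𝓝 u₀)) (hc : Tendsto c l (𝓝 c₀)) :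
    Tendsto (fun i ↦ μ.real (K ∩ {x | ⟪u i, x⟫ ≤ c i})) l
      (𝓝 (μ.real (K ∩ {x | ⟪u₀, x⟫ ≤ c₀}))) := by
  have meas : ∀ (u : E) (c : ℝ), MeasurableSet (K ∩ {x | ⟪u, x⟫ ≤ c}) := fun u c ↦
    (hK.isClosed.inter (isClosed_le (by fun_prop) (by fun_prop))).measurableSet
  refine (ENNReal.tendsto_toReal (measure_ne_top_of_subset inter_subset_left
    hK.measure_ne_top)).comp (tendsto_measure_of_ae_tendsto_indicator l (meas u₀ c₀)
    (fun i ↦ meas (u i) (c i)) hK.measurableSet hK.measure_ne_top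
    (.of_forall fun i ↦ inter_subset_left) ?_)
  have hae : ∀ᵐ x ∂μ, ⟪u₀, x⟫ ≠ c₀ := by
    simpa [ae_iff] using addHaar_setOf_inner_eq μ hu₀ c₀
  filter_upwards [hae] with x hx
  have hux : Tendsto (fun i ↦ ⟪u i, x⟫) l (𝓝 ⟪u₀, x⟫) := hu.inner tendsto_const_nhds
  rcases hx.lt_or_gt with h | h
  · filter_upwards [hux.eventually_lt hc h] with i hi
    simp [hi.le, h.le]
  · filter_upwards [hc.eventually_lt hux h] with i hi
    simp [hi.not_ge, h.not_ge]

lemma measureReal_inter_halfSpace_add (hK : IsCompact K) {u : E} (hu : u ≠ 0) (c : ℝ) :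
    μ.real (K ∩ {x | ⟪u, x⟫ ≤ c}) + μ.real (K ∩ {x | ⟪-u, x⟫ ≤ -c}) = μ.real K := by
  have h : MeasurableSet {x : E | ⟪u, x⟫ ≤ c} :=
    (isClosed_le (by fun_prop) (by fun_prop)).measurableSet
  rw [← measureReal_inter_add_sdiff (μ := μ) (s := K) h hK.measure_ne_top]
  congr 1
  refine measureReal_congr ?_
  have hae : ∀ᵐ x ∂μ, ⟪u, x⟫ ≠ c := by
    simpa [ae_iff] using addHaar_setOf_inner_eq μ hu c
  filter_upwards [hae] with x hx
  refine propext (and_congr_right fun _ ↦ ?_)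
  simpa using (Ne.symm hx).le_iff_lt

/-- Moving the half-space past a point of `K` strictly increases the measure it cuts off. -/
lemma measureReal_inter_halfSpace_lt (hK : IsCompact K) (hconv : Convex ℝ K) (hpos : 0 < μ K)
    {u v w : E} {c : ℝ} (hv : v ∈ K) (hvc : ⟪u, v⟫ < c) (hw : w ∈ K) (hwc : c ≤ ⟪u, w⟫) :
    μ.real (K ∩ {x | ⟪u, x⟫ ≤ ⟪u, v⟫}) < μ.real (K ∩ {x | ⟪u, x⟫ ≤ c}) := by
  have hint : (interior K).Nonempty := by
    by_contra! h
    refine hpos.ne' (measure_mono_null ?_ (hconv.addHaar_frontier μ))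
    rw [frontier, h, sdiff_empty]
    exact subset_closure
  obtain ⟨d, hvd, hdc⟩ := exists_between hvc
  obtain ⟨y, hy, hyd⟩ : ∃ y ∈ K, ⟪u, y⟫ = d := by
    have hf : Continuous fun x : E ↦ ⟪u, x⟫ := by fun_prop
    exact hconv.isPreconnected.intermediate_value hv hw hf.continuousOn ⟨hvd.le, hdc.le.trans hwc⟩
  set O : Set E := {x | ⟪u, v⟫ < ⟪u, x⟫} ∩ {x | ⟪u, x⟫ < c}
  have hO : IsOpen O :=
    (isOpen_lt (by fun_prop) (by fun_prop)).inter (isOpen_lt (by fun_prop) (by fun_prop))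
  have hyc : y ∈ closure (interior K) := by
    rw [hconv.closure_interior_eq_closure_of_nonempty_interior hint]
    exact subset_closure hy
  have hne : (O ∩ interior K).Nonempty :=
    mem_closure_iff.1 hyc O hO (by simp [O, hyd, hvd, hdc])
  have hμ := (hO.inter isOpen_interior).measure_pos μ hne
  have hfin : ∀ s ⊆ K, μ s ≠ ⊤ := fun s hs ↦ measure_ne_top_of_subset hs hK.measure_ne_top
  have hsub : O ∩ interior K ⊆ K := inter_subset_right.trans interior_subset
  have hle : μ.real (K ∩ {x | ⟪u, x⟫ ≤ ⟪u, v⟫} ∪ (O ∩ interior K)) ≤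
      μ.real (K ∩ {x | ⟪u, x⟫ ≤ c}) := by
    refine measureReal_mono (union_subset ?_ fun x hx ↦ ?_) (hfin _ inter_subset_left)
    · exact fun x hx ↦ ⟨hx.1, hx.2.trans hvc.le⟩
    · exact ⟨hsub hx, le_of_lt (show ⟪u, x⟫ < c from hx.1.2)⟩
  rw [measureReal_union ?_ (hO.inter isOpen_interior).measurableSet
    (hfin _ inter_subset_left) (hfin _ hsub)] at hle
  · have : 0 < μ.real (O ∩ interior K) := ENNReal.toReal_pos hμ.ne' (hfin _ hsub)
    linarith
  · exact Set.disjoint_left.2 fun x hx hx' ↦ (show ⟪u, x⟫ ≤ ⟪u, v⟫ from hx.2).not_gt hx'.1.1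

lemma exists_measureReal_inter_halfSpace_eq_half (hK : IsCompact K) {u : E} (hu : u ≠ 0) :
    ∃ c, μ.real (K ∩ {x | ⟪u, x⟫ ≤ c}) = μ.real K / 2 := by
  have hcont : Continuous fun c : ℝ ↦ μ.real (K ∩ {x | ⟪u, x⟫ ≤ c}) :=
    continuous_iff_continuousAt.2 fun c ↦
      tendsto_measureReal_inter_halfSpace μ hK hu tendsto_const_nhds tendsto_id
  have hbdd : Bornology.IsBounded ((fun x ↦ ⟪u, x⟫) '' K) :=
    (hK.image (by fun_prop)).isBounded
  obtain ⟨a, ha⟩ := hbdd.bddBelow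
  obtain ⟨b, hb⟩ := hbdd.bddAbove
  have h₁ : K ∩ {x | ⟪u, x⟫ ≤ a - 1} = ∅ := by
    refine eq_empty_of_forall_notMem fun x hx ↦ ?_
    have := ha (mem_image_of_mem _ hx.1)
    have := hx.2
    simp only [mem_ofPred_eq] at this
    linarith
  have h₂ : K ∩ {x | ⟪u, x⟫ ≤ b} = K :=
    inter_eq_left.2 fun x hx ↦ hb (mem_image_of_mem _ hx)
  have hnn : 0 ≤ μ.real K := measureReal_nonneg
  refine mem_range_of_exists_le_of_exists_ge hcont ⟨a - 1, ?_⟩ ⟨b, ?_⟩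
  · simp only [h₁, measureReal_empty]; linarith
  · simp only [h₂]; linarith

/-- The points of `F` lying strictly before the hyperplane orthogonal to `u` that halves `K`,
described through the measure of the half-space whose boundary passes through the point. -/
def pointsBeforeHalving (K F : Set E) (u : E) : Set E :=
  {v ∈ F | μ.real (K ∩ {x | ⟪u, x⟫ ≤ ⟪u, v⟫}) < μ.real K / 2}

lemma ncard_pointsBeforeHalving_add_le (hK : IsCompact K) {F : Set E} (hF : F.Finite) {u : E}
    (hu : u ≠ 0) :
    (pointsBeforeHalving μ K F u).ncard + (pointsBeforeHalving μ K F (-u)).ncard ≤ F.ncard := by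
  have hsub : ∀ u, pointsBeforeHalving μ K F u ⊆ F := fun u ↦ sep_subset _ _
  rw [← ncard_union_eq ?_ (hF.subset (hsub _)) (hF.subset (hsub _))]
  · exact ncard_le_ncard (union_subset (hsub _) (hsub _)) hF
  · refine Set.disjoint_left.2 fun v hv hv' ↦ ?_
    have := measureReal_inter_halfSpace_add μ hK hu ⟪u, v⟫
    have h₁ := hv.2
    have h₂ := hv'.2
    rw [inner_neg_left u v] at h₂
    linarith

lemma eventually_ncard_pointsBeforeHalving_le (hK : IsCompact K) {F : Set E} (hF : F.Finite)
    {u₀ : E} (hu₀ : u₀ ≠ 0) :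
    ∀ᶠ u in 𝓝 u₀,
      (pointsBeforeHalving μ K F u₀).ncard ≤ (pointsBeforeHalving μ K F u).ncard := by
  have h : ∀ᶠ u in 𝓝 u₀, ∀ v ∈ pointsBeforeHalving μ K F u₀,
      μ.real (K ∩ {x | ⟪u, x⟫ ≤ ⟪u, v⟫}) < μ.real K / 2 := by
    refine (eventually_all_finite (hF.subset (sep_subset _ _))).2 fun v hv ↦ ?_
    have hcont : Continuous fun u : E ↦ ⟪u, v⟫ := by fun_prop
    exact (tendsto_measureReal_inter_halfSpace μ hK hu₀ tendsto_id
      (hcont.tendsto u₀)).eventually_lt_const hv.2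
  filter_upwards [h] with u hu
  exact ncard_le_ncard (fun v hv ↦ ⟨hv.1, hu v hv⟩) (hF.subset (sep_subset _ _))

/-- Some halving hyperplane has at most half of a given finite set strictly on either side. -/
lemma exists_ncard_pointsBeforeHalving_le (hE : 1 < Module.rank ℝ E) (hK : IsCompact K)
    {F : Set E} (hF : F.Finite) :
    ∃ u : E, u ≠ 0 ∧ (pointsBeforeHalving μ K F u).ncard ≤ F.ncard / 2 ∧
      (pointsBeforeHalving μ K F (-u)).ncard ≤ F.ncard / 2 := by
  by_contra! hcon
  set N : E → ℕ := fun u ↦ (pointsBeforeHalving μ K F u).ncard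
  have hadd : ∀ u ≠ 0, N u + N (-u) ≤ F.ncard := fun u hu ↦
    ncard_pointsBeforeHalving_add_le μ hK hF hu
  have hopen : IsOpen {u | u ≠ 0 ∧ F.ncard / 2 < N u} := isOpen_iff_mem_nhds.2 fun u hu ↦ by
    filter_upwards [eventually_ncard_pointsBeforeHalving_le μ hK hF hu.1,
      isOpen_ne.mem_nhds hu.1] with v hv hv0
    exact ⟨hv0, hu.2.trans_le hv⟩
  have hdich : ∀ u ≠ 0, F.ncard / 2 < N u ∨ F.ncard / 2 < N (-u) := fun u hu ↦ by
    by_contra! h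
    exact (hcon u hu h.1).not_ge h.2
  have hconn := isConnected_compl_singleton_of_one_lt_rank hE (0 : E)
  obtain ⟨w, hw⟩ := hconn.nonempty
  have hnonempty : ∃ u ≠ 0, F.ncard / 2 < N u := by
    rcases hdich w hw with h | h
    exacts [⟨w, hw, h⟩, ⟨-w, neg_ne_zero.2 hw, h⟩]
  obtain ⟨u, hu0, hu⟩ := hnonempty
  obtain ⟨v, hv0, ⟨-, hv⟩, ⟨-, hv'⟩⟩ := hconn.isPreconnected _ _ hopen
    (hopen.preimage continuous_neg)
    (fun v hv ↦ (hdich v hv).imp (⟨hv, ·⟩) (⟨neg_ne_zero.2 hv, ·⟩))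
    ⟨u, hu0, hu0, hu⟩ ⟨-u, neg_ne_zero.2 hu0, by simpa using! ⟨hu0, hu⟩⟩
  have hv' : F.ncard / 2 < N (-v) := hv'
  have := hadd v hv0
  omega

end HalfSpaceMeasure

section Plane

variable {E : Type*} [NormedAddCommGroup E] [InnerProductSpace ℝ E] [Fact (finrank ℝ E = 2)]
  [FiniteDimensional ℝ E] [MeasurableSpace E] [BorelSpace E] (μ : Measure E) [μ.IsAddHaarMeasure]
  {K : Set E}

lemma ncard_extremePoints_inter_halfSpace_le (hK : IsCompact K) (hconv : Convex ℝ K)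
    (hpos : 0 < μ K) (hfin : (K.extremePoints ℝ).Finite) {u : E} (hu : u ≠ 0) {c : ℝ}
    (hc : μ.real (K ∩ {x | ⟪u, x⟫ ≤ c}) = μ.real K / 2) :
    ((K ∩ {x | ⟪u, x⟫ ≤ c}).extremePoints ℝ).ncard ≤
      (pointsBeforeHalving μ K (K.extremePoints ℝ) u).ncard + 2 := by
  have hposR : 0 < μ.real K := ENNReal.toReal_pos hpos.ne' hK.measure_ne_top
  obtain ⟨w, hw, hwc⟩ : ∃ w ∈ K, c ≤ ⟪u, w⟫ := by
    by_contra! h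
    have hKc : K ∩ {x | ⟪u, x⟫ ≤ c} = K := inter_eq_left.2 fun x hx ↦ (h x hx).le
    rw [hKc] at hc
    linarith
  have hsub : {x ∈ K.extremePoints ℝ | ⟪u, x⟫ < c} ⊆
      pointsBeforeHalving μ K (K.extremePoints ℝ) u := fun v hv ↦
    ⟨hv.1, hc ▸ measureReal_inter_halfSpace_lt μ hK hconv hpos hv.1.1 hv.2 hw hwc⟩
  have hB : (pointsBeforeHalving μ K (K.extremePoints ℝ) u).Finite :=
    hfin.subset (sep_subset _ _)
  refine (encard_le_coe_iff_finite_ncard_le.1 ?_).2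
  push_cast
  rw [hB.cast_ncard_eq]
  refine (encard_extremePoints_inter_halfSpace_le hconv hu c).trans ?_
  gcongr

end Plane

/-- A ham-sandwich-type cut of a convex polygon: a line splitting a compact convex set `K`
with `n` extreme points into two pieces of equal area, each having at most `⌊n/2⌋ + 2`
extreme points. -/
theorem exists_halving_cut_of_convex_polygon
    (K : Set (EuclideanSpace ℝ (Fin 2))) (hKc : IsCompact K) (hKconv : Convex ℝ K)
    (hpos : 0 < volume K) (n : ℕ)
    (hfin : (Set.extremePoints ℝ K).Finite)
    (hn : (Set.extremePoints ℝ K).ncard = n) :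
    ∃ (u : EuclideanSpace ℝ (Fin 2)) (c : ℝ), u ≠ 0 ∧
      volume (K ∩ {x : EuclideanSpace ℝ (Fin 2) | ⟪u, x⟫ ≤ c}) = volume K / 2 ∧
      volume (K ∩ {x : EuclideanSpace ℝ (Fin 2) | c ≤ ⟪u, x⟫}) = volume K / 2 ∧
      (Set.extremePoints ℝ (K ∩ {x : EuclideanSpace ℝ (Fin 2) | ⟪u, x⟫ ≤ c})).ncard ≤ n / 2 + 2 ∧
      (Set.extremePoints ℝ (K ∩ {x : EuclideanSpace ℝ (Fin 2) | c ≤ ⟪u, x⟫})).ncard ≤ n / 2 + 2 := by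
  have hdim : finrank ℝ (EuclideanSpace ℝ (Fin 2)) = 2 := by simp
  have : Fact (finrank ℝ (EuclideanSpace ℝ (Fin 2)) = 2) := ⟨hdim⟩
  have hrank : 1 < Module.rank ℝ (EuclideanSpace ℝ (Fin 2)) := by
    rw [← finrank_eq_rank, hdim]; norm_num
  obtain ⟨u, hu, hu₁, hu₂⟩ := exists_ncard_pointsBeforeHalving_le volume hrank hKc hfin
  obtain ⟨c, hc⟩ := exists_measureReal_inter_halfSpace_eq_half volume hKc hu
  have hc' : volume.real (K ∩ {x | ⟪-u, x⟫ ≤ -c}) = volume.real K / 2 := by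
    linarith [measureReal_inter_halfSpace_add volume hKc hu c]
  have htoReal : ∀ s ⊆ K, volume.real s = volume.real K / 2 → volume s = volume K / 2 :=
    fun s hs h ↦ (ENNReal.toReal_eq_toReal_iff' (measure_ne_top_of_subset hs hKc.measure_ne_top)
      (ENNReal.div_ne_top hKc.measure_ne_top two_ne_zero)).1 (by simpa [Measure.real] using h)
  have hset : {x | c ≤ ⟪u, x⟫} = {x | ⟪-u, x⟫ ≤ -c} := by ext x; simp
  have hb₁ := ncard_extremePoints_inter_halfSpace_le volume hKc hKconv hpos hfin hu hc
  have hb₂ := ncard_extremePoints_inter_halfSpace_le volume hKc hKconv hpos hfin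
    (neg_ne_zero.2 hu) hc'
  rw [hn] at hu₁ hu₂
  refine ⟨u, c, hu, htoReal _ inter_subset_left hc, ?_, by omega, ?_⟩ <;> rw [hset]
  · exact htoReal _ inter_subset_left hc'
  · omega
end
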